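/- arXiv:1807.05883 — 5 statements merged into one kernel-verified Lean document; each statement's English description precedes it below -/
import Mathlib

section
/- Let n ≥ 2 and let x₀,…,x_n ∈ ℝⁿ be affinely independent points spanning the n-simplex T = conv{x₀,…,x_n}, with barycenter z = (x₀+⋯+x_n)/(n+1) and Alfeld split pieces T_i = conv({z} ∪ {x_j : j ≠ i}) for 0 ≤ i ≤ n. Let 0 ≤ r ≤ n and let p₀,…,p_n : ℝⁿ → ℝ be polynomials of total degree ≤ r satisfying the C¹ matching conditions across interior faces: for all i ≠ j, p_i = p_j and ∇p_i = ∇p_j at every point of F_{ij} = T_i ∩ T_j. Then all pieces coincide: p₀ = p₁ = ⋯ = p_n, i.e. every C¹ piecewise polynomial of degree ≤ n on the Alfeld split of an n-simplex is a single polynomial. -/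
open MvPolynomial

noncomputable section

namespace AlfeldN

/-- Barycenter of the `n`-simplex with vertices `x 0, …, x n`. -/
def bary (n : ℕ) (x : Fin (n + 1) → (Fin n → ℝ)) : Fin n → ℝ :=
  ((n : ℝ) + 1)⁻¹ • ∑ k, x k

/-- The piece `T_i` of the Alfeld split of the `n`-simplex. -/
def piece (n : ℕ) (x : Fin (n + 1) → (Fin n → ℝ)) (i : Fin (n + 1)) : Set (Fin n → ℝ) :=
  convexHull ℝ (insert (bary n x) (x '' {j | j ≠ i}))

/-- The interior face `F_{ij} = T_i ∩ T_j` of the Alfeld split. -/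
def intFace (n : ℕ) (x : Fin (n + 1) → (Fin n → ℝ)) (i j : Fin (n + 1)) :
    Set (Fin n → ℝ) :=
  convexHull ℝ (insert (bary n x) (x '' {k | k ≠ i ∧ k ≠ j}))

end AlfeldN

open AlfeldN

namespace Polynomial

variable {K ι : Type*} [Field K]

/-- The parameter at which the affine functions `a i + b i * X` and `a j + b j * X` agree. -/
def crossing (a b : ι → K) (i j : ι) : K := (a j - a i) / (b i - b j)

/-- All pairs of affine functions `a i + b i * X` cross, at pairwise distinct parameters. -/
def IsGenericPencil (a b : ι → K) : Prop :=
  Function.Injective b ∧ ∀ i j k l, i ≠ j → k ≠ l → crossing a b i j = crossing a b k l →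
    i = k ∨ i = l

lemma crossing_comm (a b : ι → K) (i j : ι) : crossing a b i j = crossing a b j i := by
  rw [crossing, crossing, ← neg_sub, ← neg_sub (b j), neg_div_neg_eq]

lemma add_mul_eq_zero_iff_crossing {a b : ι → K} (hb : Function.Injective b) {i j : ι}
    (h : i ≠ j) (s : K) :
    (a i - a j) + (b i - b j) * s = 0 ↔ s = crossing a b i j := by
  have : b i - b j ≠ 0 := sub_ne_zero.2 (hb.ne h)
  rw [crossing, eq_div_iff this]
  constructor <;> intro h <;> linear_combination h

section Crossings

variable [Fintype ι] [DecidableEq K]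

/-- The set of all crossing parameters. -/
def crossings (a b : ι → K) : Finset K :=
  Finset.univ.offDiag.image fun q : ι × ι => crossing a b q.1 q.2

/-- The monic polynomial with simple roots at the crossing parameters. -/
def crossingPoly (a b : ι → K) : K[X] := ∏ s ∈ crossings a b, (X - C s)

lemma crossing_mem {a b : ι → K} {i j : ι} (h : i ≠ j) : crossing a b i j ∈ crossings a b :=
  Finset.mem_image.2 ⟨(i, j), by simpa using h, rfl⟩

lemma mem_crossings {a b : ι → K} {s : K} (h : s ∈ crossings a b) :
    ∃ i j, i ≠ j ∧ crossing a b i j = s := by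
  obtain ⟨⟨i, j⟩, hq, h⟩ := Finset.mem_image.1 h
  exact ⟨i, j, by simpa using hq, h⟩

lemma crossingPoly_monic (a b : ι → K) : (crossingPoly a b).Monic :=
  monic_prod_of_monic _ _ fun _ _ => monic_X_sub_C _

lemma eval_crossingPoly {a b : ι → K} {s : K} (hs : s ∈ crossings a b) :
    (crossingPoly a b).eval s = 0 := by
  rw [crossingPoly, eval_prod]
  exact Finset.prod_eq_zero hs (by simp)

lemma crossingPoly_dvd {a b : ι → K} {N : K[X]} (hN : ∀ s ∈ crossings a b, N.eval s = 0) :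
    crossingPoly a b ∣ N :=
  Finset.prod_dvd_of_coprime
    (fun _ _ _ _ hst => isCoprime_X_sub_C_of_isUnit_sub (sub_ne_zero.2 hst).isUnit)
    fun s hs => dvd_iff_isRoot.2 (hN s hs)

end Crossings

variable [Fintype ι] [DecidableEq ι]

/-- The product of the differences of the `i`-th affine function with all the others. -/
def diffProd (a b : ι → K) (i : ι) : K[X] :=
  ∏ j ∈ Finset.univ.erase i, (C (a i - a j) + C (b i - b j) * X)

lemma IsGenericPencil.crossing_injOn {a b : ι → K} (h : IsGenericPencil a b) (i : ι) :
    Set.InjOn (crossing a b i) (Finset.univ.erase i : Finset ι) := by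
  intro j hj k hk hjk
  have hj : j ≠ i := by simpa using hj
  have hk : k ≠ i := by simpa using hk
  rw [crossing_comm a b i j] at hjk
  exact (h.2 j i i k hj hk.symm hjk).resolve_left hj

lemma natDegree_diffProd {a b : ι → K} (hb : Function.Injective b) (i : ι) :
    (diffProd a b i).natDegree + 1 = Fintype.card ι := by
  have h : ∀ j ∈ Finset.univ.erase i, (C (a i - a j) + C (b i - b j) * X).natDegree = 1 := by
    intro j hj
    rw [add_comm]
    exact natDegree_linear (sub_ne_zero.2 (hb.ne (Finset.ne_of_mem_erase hj).symm))
  rw [diffProd, natDegree_prod _ _ fun j hj h0 => by have := h j hj; rw [h0] at this; simp at this,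
    Finset.sum_congr rfl h, ← Finset.card_univ, ← Finset.card_erase_add_one (Finset.mem_univ i)]
  simp

lemma eval_diffProd (a b : ι → K) (i : ι) (s : K) :
    (diffProd a b i).eval s =
      ∏ j ∈ Finset.univ.erase i, ((a i - a j) + (b i - b j) * s) := by
  simp [diffProd, eval_prod]

lemma eval_zero_diffProd_ne_zero {a : ι → K} (ha : Function.Injective a) (b : ι → K) (i : ι) :
    (diffProd a b i).eval 0 ≠ 0 := by
  rw [eval_diffProd, Finset.prod_ne_zero_iff]
  intro j hj
  simpa [sub_eq_zero] using ha.ne (Finset.ne_of_mem_erase hj).symm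

lemma eval_zero_derivative_diffProd {a : ι → K} (ha : Function.Injective a) (b : ι → K) (i : ι) :
    (derivative (diffProd a b i)).eval 0 =
      (diffProd a b i).eval 0 * ∑ j ∈ Finset.univ.erase i, (b i - b j) / (a i - a j) := by
  rw [eval_diffProd, diffProd, derivative_prod_finset, eval_finsetSum, Finset.mul_sum]
  refine Finset.sum_congr rfl fun j hj => ?_
  have hne : a i - a j ≠ 0 := sub_ne_zero.2 (ha.ne (Finset.ne_of_mem_erase hj).symm)
  rw [← Finset.mul_prod_erase _ _ hj]
  simp [eval_prod]
  field_simp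

variable [DecidableEq K]

/-- The quotient of `crossingPoly` by `diffProd`. -/
def cofactor (a b : ι → K) (i : ι) : K[X] :=
  C (∏ j ∈ Finset.univ.erase i, (b i - b j))⁻¹ *
    ∏ s ∈ crossings a b \ (Finset.univ.erase i).image (crossing a b i), (X - C s)

lemma diffProd_mul_cofactor {a b : ι → K} (h : IsGenericPencil a b) (i : ι) :
    diffProd a b i * cofactor a b i = crossingPoly a b := by
  have hb : ∀ j ∈ Finset.univ.erase i, b i - b j ≠ 0 := fun j hj =>
    sub_ne_zero.2 (h.1.ne (Finset.ne_of_mem_erase hj).symm)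
  have hD : diffProd a b i = C (∏ j ∈ Finset.univ.erase i, (b i - b j)) *
      ∏ s ∈ (Finset.univ.erase i).image (crossing a b i), (X - C s) := by
    rw [Finset.prod_image (h.crossing_injOn i), map_prod, ← Finset.prod_mul_distrib]
    refine Finset.prod_congr rfl fun j hj => ?_
    have : a i - a j = -((b i - b j) * crossing a b i j) := by
      rw [crossing, mul_div_cancel₀ _ (hb j hj)]; ring
    rw [this, C_neg, C_mul]; ring
  have hsub : (Finset.univ.erase i).image (crossing a b i) ⊆ crossings a b := by
    intro s hs
    obtain ⟨j, hj, rfl⟩ := Finset.mem_image.1 hs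
    exact crossing_mem (Finset.ne_of_mem_erase hj).symm
  rw [hD, cofactor, mul_mul_mul_comm, ← C_mul, mul_inv_cancel₀ (Finset.prod_ne_zero_iff.2 hb),
    C_1, one_mul, mul_comm, Finset.prod_sdiff hsub, crossingPoly]

lemma natDegree_mul_cofactor_le {a b : ι → K} (h : IsGenericPencil a b) (i : ι) (Q : K[X]) :
    (Q * cofactor a b i).natDegree + Fintype.card ι ≤
      Q.natDegree + (crossingPoly a b).natDegree + 1 := by
  have hV := (crossingPoly_monic a b).ne_zero
  rw [← diffProd_mul_cofactor h i] at hV ⊢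
  rw [natDegree_mul (left_ne_zero_of_mul hV) (right_ne_zero_of_mul hV),
    ← natDegree_diffProd (a := a) h.1 i]
  have := natDegree_mul_le (p := Q) (q := cofactor a b i)
  lia

lemma eval_cofactor_eq_zero {a b : ι → K} (h : IsGenericPencil a b) {i k l : ι}
    (hkl : k ≠ l) (hk : i ≠ k) (hl : i ≠ l) :
    (cofactor a b i).eval (crossing a b k l) = 0 := by
  have h0 := congrArg (eval (crossing a b k l)) (diffProd_mul_cofactor h i)
  rw [eval_mul, eval_crossingPoly (crossing_mem hkl)] at h0
  refine (mul_eq_zero.1 h0).resolve_left ?_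
  rw [eval_diffProd]
  refine Finset.prod_ne_zero_iff.2 fun j hj h1 => ?_
  have hj := (Finset.ne_of_mem_erase hj).symm
  rw [add_mul_eq_zero_iff_crossing h.1 hj] at h1
  rcases h.2 _ _ _ _ hj hkl h1.symm with h | h
  exacts [hk h, hl h]

lemma eval_cofactor_add {a b : ι → K} (h : IsGenericPencil a b) {k l : ι} (hkl : k ≠ l) :
    (cofactor a b k).eval (crossing a b k l) + (cofactor a b l).eval (crossing a b k l) = 0 := by
  set E : ι → ι → K[X] := fun i m =>
    ∏ j ∈ (Finset.univ.erase i).erase m, (C (a i - a j) + C (b i - b j) * X) with hE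
  have hD : ∀ i m, i ≠ m → diffProd a b i = (C (a i - a m) + C (b i - b m) * X) * E i m :=
    fun i m him => (Finset.mul_prod_erase _ _
      (Finset.mem_erase.2 ⟨him.symm, Finset.mem_univ m⟩)).symm
  have hlin : C (a k - a l) + C (b k - b l) * X ≠ 0 := by
    intro h0
    have := congrArg (fun p => coeff p 1) h0
    simp [sub_eq_zero, h.1.eq_iff, hkl] at this
  have key : E k l * cofactor a b k + E l k * cofactor a b l = 0 := by
    apply mul_left_cancel₀ hlin
    have h1 := diffProd_mul_cofactor h k
    have h2 := diffProd_mul_cofactor h l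
    rw [hD k l hkl] at h1
    rw [hD l k hkl.symm] at h2
    simp only [C_sub] at h1 h2 ⊢
    linear_combination h1 - h2
  have hcross := (add_mul_eq_zero_iff_crossing (a := a) h.1 hkl _).2 rfl
  have hEq : (E k l).eval (crossing a b k l) = (E l k).eval (crossing a b k l) := by
    simp only [hE, eval_prod]
    rw [Finset.erase_right_comm]
    refine Finset.prod_congr rfl fun j _ => ?_
    simp only [eval_add, eval_C, eval_mul, eval_X]
    linear_combination hcross
  have hne : (E k l).eval (crossing a b k l) ≠ 0 := by
    simp only [hE, eval_prod]
    rw [Finset.prod_ne_zero_iff]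
    intro j hj h0
    simp only [Finset.mem_erase] at hj
    simp only [eval_add, eval_C, eval_mul, eval_X] at h0
    rw [add_mul_eq_zero_iff_crossing h.1 hj.2.1.symm, crossing_comm a b k j,
      crossing_comm a b k l] at h0
    rcases h.2 _ _ _ _ hj.2.1 hkl.symm h0.symm with h | h
    exacts [hj.1 h, hj.2.1 h]
  have := congrArg (eval (crossing a b k l)) key
  rw [eval_add, eval_mul, eval_mul, ← hEq, ← mul_add, eval_zero] at this
  exact (mul_eq_zero.1 this).resolve_left hne

/-- Polynomials that agree pairwise at the crossings have a divided difference without poles. -/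
lemma crossingPoly_dvd_sum {a b : ι → K} (h : IsGenericPencil a b) {Q : ι → K[X]}
    (hQ : ∀ i j, i ≠ j → (Q i).eval (crossing a b i j) = (Q j).eval (crossing a b i j)) :
    crossingPoly a b ∣ ∑ i, Q i * cofactor a b i := by
  refine crossingPoly_dvd fun s hs => ?_
  obtain ⟨k, l, hkl, rfl⟩ := mem_crossings hs
  rw [eval_finsetSum, Fintype.sum_eq_add k l hkl, eval_mul, eval_mul, ← hQ k l hkl, ← mul_add,
    eval_cofactor_add h hkl, mul_zero]
  rintro i ⟨hk, hl⟩
  rw [eval_mul, eval_cofactor_eq_zero h hkl hk hl, mul_zero]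

/-- A `C¹` condition at the crossings of a generic pencil, for polynomials of degree less than the
number of pieces, annihilates the derivative of the weights `1 / diffProd`. -/
lemma sum_eval_zero_div_diffProd_eq_zero {a b : ι → K} (ha : Function.Injective a)
    (h : IsGenericPencil a b) {P : ι → K[X]} (hdeg : ∀ i, (P i).natDegree < Fintype.card ι)
    (hcard : 1 < Fintype.card ι)
    (hP : ∀ i j, i ≠ j → (P i).eval (crossing a b i j) = (P j).eval (crossing a b i j))
    (hP' : ∀ i j, i ≠ j → (derivative (P i)).eval (crossing a b i j) =
      (derivative (P j)).eval (crossing a b i j)) :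
    ∑ i, (P i).eval 0 / (∏ j ∈ Finset.univ.erase i, (a i - a j)) *
      ∑ j ∈ Finset.univ.erase i, (b i - b j) / (a i - a j) = 0 := by
  set V := crossingPoly a b with hV
  have hN : ∑ i, P i * cofactor a b i =
      V * C (∑ i, P i * cofactor a b i).leadingCoeff := by
    refine eq_mul_leadingCoeff_of_monic_of_dvd_of_natDegree_le (crossingPoly_monic a b)
      (crossingPoly_dvd_sum h hP) (natDegree_sum_le_of_forall_le _ _ fun i _ => ?_)
    have := natDegree_mul_cofactor_le h i (P i)
    have := hdeg i
    lia
  have hN' : ∑ i, derivative (P i) * cofactor a b i = 0 := by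
    by_contra hne
    have h1 := natDegree_le_of_dvd (crossingPoly_dvd_sum h hP') hne
    have h2 : (∑ i, derivative (P i) * cofactor a b i).natDegree + 1 ≤ V.natDegree := by
      have h3 : ∀ i, (derivative (P i) * cofactor a b i).natDegree + 1 ≤ V.natDegree := by
        intro i
        have h4 := natDegree_mul_cofactor_le h i (derivative (P i))
        have h5 := natDegree_derivative_le (P i)
        have h6 := hdeg i
        lia
      have h7 := natDegree_sum_le_of_forall_le (n := V.natDegree - 1) Finset.univ
        (fun i => derivative (P i) * cofactor a b i) fun i _ => by have := h3 i; lia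
      have : Nonempty ι := Fintype.card_pos_iff.1 (by lia)
      have := h3 (Classical.arbitrary ι)
      lia
    lia
  generalize (∑ i, P i * cofactor a b i).leadingCoeff = c at hN
  have hd := congrArg derivative hN
  simp only [derivative_sum, derivative_mul, Finset.sum_add_distrib, derivative_C, mul_zero,
    add_zero, hN', zero_add] at hd
  replace hN := congrArg (eval 0) hN
  replace hd := congrArg (eval 0) hd
  simp only [eval_finsetSum, eval_mul, eval_C] at hN hd
  have hVi : ∀ i, (diffProd a b i).eval 0 * (cofactor a b i).eval 0 = V.eval 0 := fun i => by
    rw [← eval_mul, diffProd_mul_cofactor h i]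
  have hVi' : ∀ i, (derivative (diffProd a b i)).eval 0 * (cofactor a b i).eval 0 +
      (diffProd a b i).eval 0 * (derivative (cofactor a b i)).eval 0 =
        (derivative V).eval 0 := fun i => by
    rw [← eval_mul, ← eval_mul, ← eval_add, ← derivative_mul, diffProd_mul_cofactor h i]
  have hV0 : V.eval 0 ≠ 0 := by
    rw [hV, crossingPoly, eval_prod, Finset.prod_ne_zero_iff]
    intro s hs
    obtain ⟨i, j, hij, rfl⟩ := mem_crossings hs
    simp [crossing, sub_eq_zero, ha.eq_iff, h.1.eq_iff, hij, hij.symm]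
  have hterm : ∀ i, V.eval 0 * V.eval 0 *
      ((P i).eval 0 / (∏ j ∈ Finset.univ.erase i, (a i - a j)) *
        ∑ j ∈ Finset.univ.erase i, (b i - b j) / (a i - a j)) =
      (derivative V).eval 0 * ((P i).eval 0 * (cofactor a b i).eval 0) -
        V.eval 0 * ((P i).eval 0 * (derivative (cofactor a b i)).eval 0) := by
    intro i
    have hD := eval_zero_diffProd_ne_zero ha b i
    have hD0 : ∏ j ∈ Finset.univ.erase i, (a i - a j) = (diffProd a b i).eval 0 := by
      simp [eval_diffProd]
    rw [← hVi' i, eval_zero_derivative_diffProd ha, hD0, ← hVi i]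
    field_simp
    ring
  have := Finset.sum_congr rfl fun i (_ : i ∈ Finset.univ) => hterm i
  rw [← Finset.mul_sum, Finset.sum_sub_distrib, ← Finset.mul_sum, ← Finset.mul_sum, hN, hd] at this
  refine (mul_eq_zero.1 (this.trans ?_)).resolve_left (mul_ne_zero hV0 hV0)
  ring

end Polynomial

section Moments

variable {K ι : Type*} [Field K] [Fintype ι] [DecidableEq ι]

lemma exists_isGenericPencil_apply_ne_zero [Infinite K] {a : ι → K} (ha : Function.Injective a)
    {E : Module.Dual K (ι → K)} (hE : E ≠ 0) :
    ∃ b, Polynomial.IsGenericPencil a b ∧ E b ≠ 0 := by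
  let π : ι → Module.Dual K (ι → K) := fun i => LinearMap.proj i
  let f : Option ({q : ι × ι // q.1 ≠ q.2} ⊕ {q : (ι × ι) × (ι × ι) //
      q.2.1 ≠ q.2.2 ∧ q.1.1 ≠ q.1.2 ∧ q.1.1 ≠ q.2.1 ∧ q.1.1 ≠ q.2.2}) → Module.Dual K (ι → K)
    | none => E
    | some (.inl q) => π q.1.1 - π q.1.2
    | some (.inr q) => (a q.1.1.2 - a q.1.1.1) • (π q.1.2.1 - π q.1.2.2) -
        (a q.1.2.2 - a q.1.2.1) • (π q.1.1.1 - π q.1.1.2)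
  obtain ⟨b, hb⟩ := Module.Dual.exists_forall_ne_zero_of_forall_exists f (by
    rintro (_ | ⟨⟨i, j⟩, h⟩ | ⟨⟨⟨i, j⟩, k, l⟩, hkl, hij, hik, hil⟩)
    · by_contra! h0
      exact hE (LinearMap.ext h0)
    · have h : j ≠ i := Ne.symm h
      exact ⟨Pi.single i 1, by simp [f, π, h]⟩
    · dsimp only at hkl hij hik hil
      refine ⟨Pi.single i 1, ?_⟩
      simp [f, π, hij.symm, hik.symm, hil.symm, sub_eq_zero, ha.eq_iff, hkl])
  have hinj : Function.Injective b := by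
    intro i j hij
    by_contra hne
    exact hb (some (.inl ⟨(i, j), hne⟩)) (by simp [f, π, hij])
  refine ⟨b, ⟨hinj, fun i j k l hij hkl h => ?_⟩, hb none⟩
  by_contra! hne
  refine hb (some (.inr ⟨((i, j), (k, l)), hkl, hij, hne⟩)) ?_
  rw [Polynomial.crossing, Polynomial.crossing, div_eq_div_iff (sub_ne_zero.2 (hinj.ne hij))
    (sub_ne_zero.2 (hinj.ne hkl))] at h
  simpa [f, π, sub_eq_zero] using h

variable [CharZero K]

lemma sum_mul_pow_eq_zero {t u : ι → K} (ht : Function.Injective t)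
    (h : ∀ b : ι → K,
      ∑ i, u i * ∑ j ∈ Finset.univ.erase i, (b i - b j) / (t i - t j) = 0) :
    ∀ m, m + 1 < Fintype.card ι → ∑ i, u i * t i ^ m = 0 := by
  intro m
  induction m using Nat.strong_induction_on with
  | _ m ih =>
  intro hm
  have hb := h fun i => t i ^ (m + 1)
  have hi : ∀ i, ∑ j ∈ Finset.univ.erase i, (t i ^ (m + 1) - t j ^ (m + 1)) / (t i - t j) =
      ∑ d ∈ Finset.range (m + 1), t i ^ d * ∑ j, t j ^ (m - d) - (m + 1) * t i ^ m := by
    intro i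
    have h1 : ∀ j ∈ Finset.univ.erase i, (t i ^ (m + 1) - t j ^ (m + 1)) / (t i - t j) =
        ∑ d ∈ Finset.range (m + 1), t i ^ d * t j ^ (m - d) := by
      intro j hj
      rw [div_eq_iff (sub_ne_zero.2 (ht.ne (Finset.ne_of_mem_erase hj).symm))]
      simpa using ((Commute.all (t i) (t j)).geom_sum₂_mul (m + 1)).symm
    have h2 : ∑ d ∈ Finset.range (m + 1), t i ^ d * t i ^ (m - d) = (m + 1) * t i ^ m := by
      rw [Finset.sum_congr rfl fun d hd => by
        rw [← pow_add, Nat.add_sub_cancel' (Finset.mem_range_succ_iff.1 hd)]]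
      simp
    rw [Finset.sum_congr rfl h1, ← h2, eq_sub_iff_add_eq,
      Finset.sum_erase_add _ (fun j => ∑ d ∈ Finset.range (m + 1), t i ^ d * t j ^ (m - d))
        (Finset.mem_univ i), Finset.sum_comm]
    simp_rw [Finset.mul_sum]
  simp_rw [hi, mul_sub, Finset.sum_sub_distrib, Finset.mul_sum (Finset.range (m + 1))] at hb
  rw [Finset.sum_comm, Finset.sum_range_succ, Finset.sum_eq_zero, zero_add] at hb
  · have hc : ((Fintype.card ι : K) - (m + 1)) * ∑ i, u i * t i ^ m = 0 := by
      rw [← hb, ← Finset.sum_sub_distrib, Finset.mul_sum]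
      refine Finset.sum_congr rfl fun i _ => ?_
      simp
      ring
    refine (mul_eq_zero.1 hc).resolve_left (sub_ne_zero.2 ?_)
    exact_mod_cast hm.ne'
  · intro d hd
    have hd := Finset.mem_range.1 hd
    have := ih d hd (by lia)
    simp_rw [← mul_assoc, ← Finset.sum_mul, this, zero_mul]

/-- If all the derivatives of a divided difference with respect to the weights vanish, then the
divided values are all equal. -/
lemma eq_of_forall_sum_div_prod_eq_zero {t c : ι → K} (ht : Function.Injective t)
    (h : ∀ b : ι → K, ∑ i, c i / (∏ j ∈ Finset.univ.erase i, (t i - t j)) *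
      ∑ j ∈ Finset.univ.erase i, (b i - b j) / (t i - t j) = 0) (i j : ι) : c i = c j := by
  by_cases hij : i = j
  · rw [hij]
  have hmom := sum_mul_pow_eq_zero ht h
  set f : Polynomial K :=
    ∏ k ∈ (Finset.univ.erase i).erase j, (Polynomial.X - Polynomial.C (t k)) with hf
  have hmem : j ∈ Finset.univ.erase i := by simpa using Ne.symm hij
  have hdeg : f.natDegree + 2 = Fintype.card ι := by
    rw [hf, Polynomial.natDegree_finsetProd_X_sub_C_eq_card, ← Finset.card_univ,
      ← Finset.card_erase_add_one (Finset.mem_univ i), ← Finset.card_erase_add_one hmem]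
  have hsum : ∑ k, c k / (∏ j ∈ Finset.univ.erase k, (t k - t j)) * f.eval (t k) = 0 := by
    simp_rw [Polynomial.eval_eq_sum_range, Finset.mul_sum]
    rw [Finset.sum_comm]
    refine Finset.sum_eq_zero fun d hd => ?_
    have hd := Finset.mem_range.1 hd
    rw [← mul_zero (f.coeff d), ← hmom d (by lia), Finset.mul_sum]
    exact Finset.sum_congr rfl fun k _ => by ring
  have hfe : ∀ s, f.eval s = ∏ k ∈ (Finset.univ.erase i).erase j, (s - t k) := fun s => by
    simp [hf, Polynomial.eval_prod]
  have hi : ∏ k ∈ Finset.univ.erase i, (t i - t k) = (t i - t j) * f.eval (t i) := by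
    rw [hfe, Finset.mul_prod_erase _ (fun k => t i - t k) hmem]
  have hj : ∏ k ∈ Finset.univ.erase j, (t j - t k) = (t j - t i) * f.eval (t j) := by
    rw [hfe, Finset.erase_right_comm, Finset.mul_prod_erase _ (fun k => t j - t k)
      (by simpa using hij)]
  have hfi : f.eval (t i) ≠ 0 := by
    rw [hfe]
    refine Finset.prod_ne_zero_iff.2 fun k hk => sub_ne_zero.2 (ht.ne ?_)
    simp only [Finset.mem_erase] at hk
    exact hk.2.1.symm
  have hfj : f.eval (t j) ≠ 0 := by
    rw [hfe]
    refine Finset.prod_ne_zero_iff.2 fun k hk => sub_ne_zero.2 (ht.ne ?_)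
    simp only [Finset.mem_erase] at hk
    exact hk.1.symm
  rw [Fintype.sum_eq_add i j hij, hi, hj] at hsum
  · have h1 : t i - t j ≠ 0 := sub_ne_zero.2 (ht.ne hij)
    have h2 : t j - t i ≠ 0 := sub_ne_zero.2 (ht.ne (Ne.symm hij))
    have h3 : c i * (t j - t i) + c j * (t i - t j) = 0 := by
      field_simp at hsum
      linear_combination hsum
    refine sub_eq_zero.1 ((mul_eq_zero.1 ?_).resolve_right h1)
    linear_combination -h3
  · rintro k ⟨hki, hkj⟩
    rw [hfe, Finset.prod_eq_zero (i := k) (s := (Finset.univ.erase i).erase j)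
      (by simp [hki, hkj]) (sub_self _), mul_zero]

end Moments

namespace MvPolynomial

variable {σ R : Type*} [CommRing R]

lemma derivative_aeval [Fintype σ] (f : σ → Polynomial R) (q : MvPolynomial σ R) :
    Polynomial.derivative (aeval f q) =
      ∑ c, Polynomial.derivative (f c) * aeval f (pderiv c q) := by
  classical
  induction q using MvPolynomial.induction_on with
  | C r => simp
  | add p q hp hq => simp [hp, hq, mul_add, Finset.sum_add_distrib]
  | mul_X p c hp =>
    simp only [map_mul, aeval_X, Polynomial.derivative_mul, hp, Derivation.leibniz, smul_eq_mul,
      map_add, mul_add, Finset.sum_add_distrib, pderiv_X, Pi.single_apply, apply_ite (aeval f),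
      map_zero, mul_ite, mul_one, mul_zero, Finset.sum_ite_eq, Finset.mem_univ, if_true]
    rw [Finset.sum_mul, add_comm, mul_comm]
    congr 1
    exact Finset.sum_congr rfl fun _ _ => by ring

/-- The restriction of a polynomial to the line `s ↦ v + s • u`. -/
def lineRestrict (v u : σ → R) (q : MvPolynomial σ R) : Polynomial R :=
  aeval (fun c => Polynomial.C (u c) * Polynomial.X + Polynomial.C (v c)) q

lemma eval_lineRestrict (v u : σ → R) (q : MvPolynomial σ R) (s : R) :
    (lineRestrict v u q).eval s = eval (v + s • u) q := by
  rw [lineRestrict, ← Polynomial.coe_aeval_eq_eval, comp_aeval_apply, ← coe_aeval_eq_eval,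
    RingHom.coe_coe]
  congr 2
  ext c
  simp
  ring

lemma natDegree_lineRestrict_le (v u : σ → R) (q : MvPolynomial σ R) :
    (lineRestrict v u q).natDegree ≤ q.totalDegree :=
  (aeval_natDegree_le q le_rfl _ fun _ => Polynomial.natDegree_linear_le).trans_eq (mul_one _)

lemma derivative_lineRestrict [Fintype σ] (v u : σ → R) (q : MvPolynomial σ R) :
    Polynomial.derivative (lineRestrict v u q) =
      ∑ c, Polynomial.C (u c) * lineRestrict v u (pderiv c q) := by
  simp [lineRestrict, derivative_aeval]

end MvPolynomial

namespace AlfeldN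

variable {n : ℕ} {x : Fin (n + 1) → (Fin n → ℝ)}

/-- The linear parametrization of `ℝⁿ` by weights of the vectors from the barycenter to the
vertices. -/
def weightMap (n : ℕ) (x : Fin (n + 1) → (Fin n → ℝ)) (t : Fin (n + 1) → ℝ) : Fin n → ℝ :=
  bary n x + ∑ k, t k • (x k - bary n x)

lemma sum_sub_bary (n : ℕ) (x : Fin (n + 1) → (Fin n → ℝ)) : ∑ k, (x k - bary n x) = 0 := by
  have : ((n : ℝ) + 1) ≠ 0 := by positivity
  rw [Finset.sum_sub_distrib, Finset.sum_const, Finset.card_univ, Fintype.card_fin,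
    ← Nat.cast_smul_eq_nsmul ℝ, bary, smul_smul, Nat.cast_add_one, mul_inv_cancel₀ this, one_smul,
    sub_self]

lemma weightMap_sub_const (t : Fin (n + 1) → ℝ) (c : ℝ) :
    weightMap n x (fun k => t k - c) = weightMap n x t := by
  simp_rw [weightMap, sub_smul, Finset.sum_sub_distrib, ← Finset.smul_sum, sum_sub_bary, smul_zero,
    sub_zero]

lemma weightMap_surjective (hx : AffineIndependent ℝ x) : Function.Surjective (weightMap n x) := by
  intro y
  let B : AffineBasis (Fin (n + 1)) ℝ (Fin n → ℝ) :=
    ⟨x, hx, by rw [hx.affineSpan_eq_top_iff_card_eq_finrank_add_one]; simp⟩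
  refine ⟨fun k => B.coord k y, ?_⟩
  have h1 : ∑ k, B.coord k y • x k = y := B.linear_combination_coord_eq_self y
  simp_rw [weightMap, smul_sub, Finset.sum_sub_distrib, ← Finset.sum_smul,
    B.sum_coord_apply_eq_one, h1, one_smul, add_sub_cancel]

lemma weightMap_mem_intFace {i j : Fin (n + 1)} {t : Fin (n + 1) → ℝ}
    (ht : ∀ k, t k ∈ Set.Icc 0 ((n : ℝ) + 1)⁻¹) (hi : t i = 0) (hj : t j = 0) :
    weightMap n x t ∈ intFace n x i j := by
  have hpos : (0 : ℝ) < n + 1 := by positivity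
  have hconv : Convex ℝ (intFace n x i j) := convex_convexHull ℝ _
  have hz : bary n x ∈ intFace n x i j := subset_convexHull ℝ _ (Set.mem_insert _ _)
  have hmem : ∀ k, bary n x + ((n + 1) * t k) • (x k - bary n x) ∈ intFace n x i j := by
    intro k
    by_cases hk : k ≠ i ∧ k ≠ j
    · refine hconv.add_smul_sub_mem hz
        (subset_convexHull ℝ _ (Set.mem_insert_of_mem _ ⟨k, hk, rfl⟩)) ⟨?_, ?_⟩
      · exact mul_nonneg hpos.le (ht k).1
      · exact (mul_le_mul_of_nonneg_left (ht k).2 hpos.le).trans_eq (mul_inv_cancel₀ hpos.ne')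
    · have : t k = 0 := by
        by_cases h : k = i
        · rw [h, hi]
        · rw [not_and_not_right.1 hk h, hj]
      simpa [this] using hz
  convert hconv.sum_mem (t := Finset.univ)
    (w := fun _ : Fin (n + 1) => ((n : ℝ) + 1)⁻¹) (fun _ _ => by positivity)
    (by simp [hpos.ne']) (fun k _ => hmem k) using 1
  simp only [smul_add, smul_smul, inv_mul_cancel_left₀ hpos.ne', Finset.sum_add_distrib, weightMap]
  rw [Finset.sum_const, Finset.card_univ, Fintype.card_fin, ← Nat.cast_smul_eq_nsmul ℝ, smul_smul,
    Nat.cast_add_one, mul_inv_cancel₀ hpos.ne', one_smul]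

/-- A polynomial vanishing on an interior face vanishes on the hyperplane spanned by the face. -/
lemma eval_weightMap_eq_zero {i j : Fin (n + 1)} {q : MvPolynomial (Fin n) ℝ}
    (hq : ∀ y ∈ intFace n x i j, eval y q = 0) {t : Fin (n + 1) → ℝ} (ht : t i = t j) :
    eval (weightMap n x t) q = 0 := by
  let Z : (Fin (n + 1) → ℝ) → Fin (n + 1) → ℝ := fun t k => if k = i ∨ k = j then 0 else t k
  let Q : MvPolynomial (Fin (n + 1)) ℝ := bind₁ (fun c => C (bary n x c) +
    ∑ k, (if k = i ∨ k = j then 0 else X k) * C (x k c - bary n x c)) q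
  have hQ : ∀ t, eval t Q = eval (weightMap n x (Z t)) q := by
    intro t
    simp only [Q, ← coe_aeval_eq_eval, RingHom.coe_coe, aeval_bind₁]
    congr 2
    ext c
    simp only [weightMap, Z, ite_smul, zero_smul, Pi.add_apply, Finset.sum_apply, map_add, map_sum,
      map_mul, aeval_C, Algebra.algebraMap_self, RingHom.id_apply]
    congr 1
    refine Finset.sum_congr rfl fun k _ => ?_
    split_ifs <;> simp
  have hQ0 : Q = 0 := by
    refine MvPolynomial.funext_set (fun _ => Set.Icc 0 ((n : ℝ) + 1)⁻¹)
      (fun _ => Set.Icc_infinite (by positivity)) fun t ht => ?_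
    rw [hQ, map_zero]
    refine hq _ (weightMap_mem_intFace (fun k => ?_) (by simp [Z]) (by simp [Z]))
    by_cases hk : k = i ∨ k = j
    · simp only [Z, if_pos hk]
      exact ⟨le_rfl, by positivity⟩
    · simp only [Z, if_neg hk]
      exact ht k trivial
  have hZ : Z (fun k => t k - t i) = fun k => t k - t i := by
    ext k
    by_cases hk : k = i ∨ k = j
    · rcases hk with rfl | rfl <;> simp [Z, ht]
    · simp [Z, hk]
  rw [← weightMap_sub_const t (t i), ← hZ, ← hQ, hQ0, map_zero]

lemma weightMap_add_mul (a b : Fin (n + 1) → ℝ) (s : ℝ) :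
    weightMap n x (fun k => a k + b k * s) =
      weightMap n x a + s • ∑ k, b k • (x k - bary n x) := by
  simp_rw [weightMap, add_smul, Finset.sum_add_distrib, Finset.smul_sum, smul_smul, mul_comm s,
    add_assoc]

end AlfeldN

/-- every `C¹` piecewise polynomial of degree `≤ n` on the Alfeld split of an
`n`-simplex is a single polynomial. -/
theorem statement12 (n r : ℕ) (hn : 2 ≤ n) (hr : r ≤ n)
    (x : Fin (n + 1) → (Fin n → ℝ)) (hx : AffineIndependent ℝ x)
    (p : Fin (n + 1) → MvPolynomial (Fin n) ℝ)
    (hdeg : ∀ i, (p i).totalDegree ≤ r)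
    (hC1 : ∀ i j, i ≠ j → ∀ y ∈ intFace n x i j,
      eval y (p i) = eval y (p j) ∧
        ∀ c, eval y (pderiv c (p i)) = eval y (pderiv c (p j))) :
    ∀ i j, p i = p j := by
  have hval : ∀ i j, i ≠ j → ∀ t : Fin (n + 1) → ℝ, t i = t j →
      eval (weightMap n x t) (p i) = eval (weightMap n x t) (p j) := by
    intro i j hij t ht
    rw [← sub_eq_zero, ← map_sub]
    refine eval_weightMap_eq_zero (fun y hy => ?_) ht
    rw [map_sub, (hC1 i j hij y hy).1, sub_self]
  have hgrad : ∀ i j, i ≠ j → ∀ t : Fin (n + 1) → ℝ, t i = t j → ∀ c,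
      eval (weightMap n x t) (pderiv c (p i)) = eval (weightMap n x t) (pderiv c (p j)) := by
    intro i j hij t ht c
    rw [← sub_eq_zero, ← map_sub]
    refine eval_weightMap_eq_zero (fun y hy => ?_) ht
    rw [map_sub, (hC1 i j hij y hy).2 c, sub_self]
  have hinj : ∀ t : Fin (n + 1) → ℝ, Function.Injective t → ∀ i j,
      eval (weightMap n x t) (p i) = eval (weightMap n x t) (p j) := by
    intro t ht
    refine eq_of_forall_sum_div_prod_eq_zero ht fun b => ?_
    let E : Module.Dual ℝ (Fin (n + 1) → ℝ) := ∑ i,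
      (eval (weightMap n x t) (p i) / ∏ j ∈ Finset.univ.erase i, (t i - t j)) •
        ∑ j ∈ Finset.univ.erase i, (t i - t j)⁻¹ •
          ((LinearMap.proj i : Module.Dual ℝ (Fin (n + 1) → ℝ)) - LinearMap.proj j)
    have hE : ∀ b, E b = ∑ i, eval (weightMap n x t) (p i) /
        (∏ j ∈ Finset.univ.erase i, (t i - t j)) *
          ∑ j ∈ Finset.univ.erase i, (b i - b j) / (t i - t j) := by
      intro b
      simp [E, LinearMap.sum_apply, div_eq_inv_mul]
    suffices E = 0 by rw [← hE, this, LinearMap.zero_apply]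
    by_contra hE0
    obtain ⟨b, hb, hEb⟩ := exists_isGenericPencil_apply_ne_zero ht hE0
    have hcross : ∀ i j, i ≠ j → t i + b i * Polynomial.crossing t b i j =
        t j + b j * Polynomial.crossing t b i j := by
      intro i j hij
      have := (Polynomial.add_mul_eq_zero_iff_crossing (a := t) hb.1 hij _).2 rfl
      linear_combination this
    have h := Polynomial.sum_eval_zero_div_diffProd_eq_zero ht hb
      (P := fun i => lineRestrict (weightMap n x t) (∑ k, b k • (x k - bary n x)) (p i))
      (fun i => by
        have := natDegree_lineRestrict_le (weightMap n x t) (∑ k, b k • (x k - bary n x)) (p i)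
        have := hdeg i
        rw [Fintype.card_fin]
        lia)
      (by rw [Fintype.card_fin]; lia)
      (fun i j hij => by
        rw [eval_lineRestrict, eval_lineRestrict, ← weightMap_add_mul]
        exact hval i j hij _ (hcross i j hij))
      (fun i j hij => by
        simp only [derivative_lineRestrict, Polynomial.eval_finsetSum, Polynomial.eval_mul,
          eval_lineRestrict, ← weightMap_add_mul]
        exact Finset.sum_congr rfl fun c _ => by
          rw [hgrad i j hij _ (hcross i j hij) c])
    refine hEb ?_
    rw [hE]
    simpa only [eval_lineRestrict, zero_smul, add_zero] using h
  intro i j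
  have hline : ∀ (q : MvPolynomial (Fin n) ℝ) t, eval t (bind₁ (fun c => C (bary n x c) +
      ∑ k, X k * C (x k c - bary n x c)) q) = eval (weightMap n x t) q := by
    intro q t
    simp only [← coe_aeval_eq_eval, RingHom.coe_coe, aeval_bind₁]
    congr 2
    ext c
    simp [weightMap, Finset.sum_apply]
  have hbind := MvPolynomial.funext_set
    (fun k : Fin (n + 1) => Set.Ioo (k : ℝ) (k + 1)) (fun k => Set.Ioo_infinite (by simp))
    (p := bind₁ (fun c => C (bary n x c) + ∑ k, X k * C (x k c - bary n x c)) (p i))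
    (q := bind₁ (fun c => C (bary n x c) + ∑ k, X k * C (x k c - bary n x c)) (p j))
    fun t ht => by
      rw [hline, hline]
      refine hinj t (fun k l hkl => ?_) i j
      have hk := ht k trivial
      have hl := ht l trivial
      simp only [Set.mem_Ioo] at hk hl
      have h1 : (k : ℕ) < l + 1 := by exact_mod_cast (show (k : ℝ) < l + 1 by linarith)
      have h2 : (l : ℕ) < k + 1 := by exact_mod_cast (show (l : ℝ) < k + 1 by linarith)
      exact Fin.ext (by lia)
  refine MvPolynomial.funext fun y => ?_
  obtain ⟨t, rfl⟩ := weightMap_surjective hx y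
  rw [← hline, ← hline, hbind]
end
end

section
/- Let n ≥ 2 and r ≥ 0 be integers and let x₀,…,x_n ∈ ℝⁿ be affinely independent points spanning the n-simplex T = conv{x₀,…,x_n}, with barycenter z and Alfeld split pieces T_i = conv({z} ∪ {x_j : j ≠ i}). The real vector space of tuples (p₀,…,p_n) of polynomials ℝⁿ → ℝ of total degree ≤ r satisfying the C¹ matching conditions p_i = p_j and ∇p_i = ∇p_j at every point of F_{ij} = T_i ∩ T_j for all i ≠ j (i.e. the space of C¹ piecewise polynomials of degree ≤ r on the Alfeld split of T) has dimension C(r+n, n) + n·C(r−1, n), where C(a,b) denotes the binomial coefficient (equal to 0 when a < b, and C(r−1,n) is interpreted as 0 when r = 0). -/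
open MvPolynomial

noncomputable section

namespace AlfeldN

/-- The space of `C¹` piecewise polynomials of degree at most `r` on the Alfeld split of the
`n`-simplex with vertices `x 0, …, x n`: tuples `(p 0, …, p n)` of polynomials of total
degree at most `r` such that for all `i ≠ j` the values and the gradients of `p i` and
`p j` agree at every point of the interior face `F_{ij}`. -/
def C1Space (n r : ℕ) (x : Fin (n + 1) → (Fin n → ℝ)) :
    Submodule ℝ (Fin (n + 1) → MvPolynomial (Fin n) ℝ) where
  carrier := {p | (∀ i, (p i).totalDegree ≤ r) ∧
    ∀ i j, i ≠ j → ∀ y ∈ intFace n x i j,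
      eval y (p i) = eval y (p j) ∧
        ∀ c, eval y (pderiv c (p i)) = eval y (pderiv c (p j))}
  add_mem' := by
    intro a b ha hb
    obtain ⟨ha1, ha2⟩ := ha
    obtain ⟨hb1, hb2⟩ := hb
    constructor
    · intro i
      exact (totalDegree_add (a i) (b i)).trans (max_le (ha1 i) (hb1 i))
    · intro i j hij y hy
      obtain ⟨h1, h2⟩ := ha2 i j hij y hy
      obtain ⟨h3, h4⟩ := hb2 i j hij y hy
      refine ⟨?_, ?_⟩
      · simp only [Pi.add_apply, map_add, h1, h3]
      · intro c
        simp only [Pi.add_apply, map_add, h2 c, h4 c]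
  zero_mem' := by
    constructor
    · intro i
      simp
    · intro i j hij y hy
      simp
  smul_mem' := by
    intro s a ha
    obtain ⟨ha1, ha2⟩ := ha
    constructor
    · intro i
      exact (totalDegree_smul_le s (a i)).trans (ha1 i)
    · intro i j hij y hy
      obtain ⟨h1, h2⟩ := ha2 i j hij y hy
      refine ⟨?_, ?_⟩
      · simp only [Pi.smul_apply, smul_eval, h1]
      · intro c
        simp only [Pi.smul_apply]
        rw [Derivation.map_smul, Derivation.map_smul, smul_eval, smul_eval, h2 c]

end AlfeldN

open AlfeldN

/-- A polynomial in `t` with coefficients in `ℝ[σ]` whose joint total degree is at most `d`. -/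
def JointDegreeLE {σ : Type*} (d : ℕ) (P : Polynomial (MvPolynomial σ ℝ)) : Prop :=
  ∀ m, P.coeff m ≠ 0 → (P.coeff m).totalDegree + m ≤ d

namespace JointDegreeLE

variable {σ : Type*}

theorem natDegree_le {d : ℕ} {P : Polynomial (MvPolynomial σ ℝ)} (h : JointDegreeLE d P) :
    P.natDegree ≤ d :=
  Polynomial.natDegree_le_iff_coeff_eq_zero.2 fun m hm => by
    by_contra hne
    have := h m hne
    omega

theorem mul {d e : ℕ} {P Q : Polynomial (MvPolynomial σ ℝ)} (hP : JointDegreeLE d P)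
    (hQ : JointDegreeLE e Q) : JointDegreeLE (d + e) (P * Q) := by
  intro m hm
  rw [Polynomial.coeff_mul] at hm ⊢
  obtain ⟨⟨a₀, b₀⟩, hab₀, hne₀⟩ := Finset.exists_ne_zero_of_sum_ne_zero hm
  have hm' : m ≤ d + e := by
    have h1 := hP a₀ (left_ne_zero_of_mul hne₀)
    have h2 := hQ b₀ (right_ne_zero_of_mul hne₀)
    simp only [Finset.HasAntidiagonal.mem_antidiagonal] at hab₀
    omega
  suffices h : (∑ x ∈ Finset.HasAntidiagonal.antidiagonal m, P.coeff x.1 * Q.coeff x.2).totalDegree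
      ≤ d + e - m by omega
  refine totalDegree_finsetSum_le fun x hx => ?_
  by_cases h1 : P.coeff x.1 = 0
  · simp [h1]
  by_cases h2 : Q.coeff x.2 = 0
  · simp [h2]
  have h3 := hP _ h1
  have h4 := hQ _ h2
  have h5 := totalDegree_mul (P.coeff x.1) (Q.coeff x.2)
  simp only [Finset.HasAntidiagonal.mem_antidiagonal] at hx
  omega

theorem prod_X_sub_C {ι : Type*} (s : Finset ι) (u : ι → MvPolynomial σ ℝ)
    (hu : ∀ i, (u i).totalDegree ≤ 1) :
    JointDegreeLE s.card (∏ i ∈ s, (Polynomial.X - Polynomial.C (u i))) := by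
  classical
  induction s using Finset.induction_on with
  | empty =>
    intro m hm
    simp only [Finset.prod_empty, Polynomial.coeff_one, ne_eq, ite_eq_right_iff,
      one_ne_zero, imp_false, not_not] at hm
    simp [hm]
  | insert a s ha ih =>
    rw [Finset.prod_insert ha, Finset.card_insert_of_notMem ha, add_comm]
    refine mul (fun m hm => ?_) ih
    rcases m with _ | _ | m
    · simpa using hu a
    · simp [Polynomial.coeff_X]
    · exact absurd (by simp [Polynomial.coeff_X]) hm

theorem totalDegree_eval_le {d : ℕ} {P : Polynomial (MvPolynomial σ ℝ)} (h : JointDegreeLE d P)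
    {v : MvPolynomial σ ℝ} (hv : v.totalDegree ≤ 1) : (P.eval v).totalDegree ≤ d := by
  rw [Polynomial.eval_eq_sum_range]
  refine totalDegree_finsetSum_le fun m _ => ?_
  by_cases h0 : P.coeff m = 0
  · simp [h0]
  have h1 := h m h0
  have h2 := totalDegree_mul (P.coeff m) (v ^ m)
  have h3 := totalDegree_pow v m
  have h4 : m * v.totalDegree ≤ m := by nlinarith
  omega

theorem exists_derivative_eq {d : ℕ} {P : Polynomial (MvPolynomial σ ℝ)}
    (h : JointDegreeLE d P) :
    ∃ Q, Polynomial.derivative Q = P ∧ JointDegreeLE (d + 1) Q := by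
  classical
  refine ⟨∑ m ∈ P.support, Polynomial.monomial (m + 1) (((m : ℝ) + 1)⁻¹ • P.coeff m), ?_, ?_⟩
  · rw [map_sum]
    conv_rhs => rw [P.as_sum_support]
    refine Finset.sum_congr rfl fun m _ => ?_
    rw [Polynomial.derivative_monomial]
    congr 1
    have h2 : ((m + 1 : ℕ) : MvPolynomial σ ℝ) = C ((m : ℝ) + 1) := by simp
    have h3 : ((m : ℝ) + 1) ≠ 0 := by positivity
    rw [h2, smul_eq_C_mul, mul_right_comm, ← C_mul, inv_mul_cancel₀ h3, C_1, one_mul]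
  · intro m hm
    simp only [Polynomial.finsetSum_coeff, Polynomial.coeff_monomial] at hm ⊢
    rcases m with _ | m
    · simp at hm
    · simp only [add_left_inj, Finset.sum_ite_eq', Polynomial.mem_support_iff] at hm ⊢
      have h1 : P.coeff m ≠ 0 := fun h0 => hm (by simp [h0])
      rw [if_pos h1]
      have := h m h1
      have := totalDegree_smul_le ((m : ℝ) + 1)⁻¹ (P.coeff m)
      omega

end JointDegreeLE

/-- If the derivative of `P` vanishes at `a`, then `P b - P a` vanishes to second order. -/
theorem sq_dvd_eval_sub_eval {R : Type*} [CommRing R] {P : Polynomial R} {a b : R}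
    (h : P.derivative.eval a = 0) : (b - a) ^ 2 ∣ P.eval b - P.eval a := by
  obtain ⟨k, hk⟩ := P.binomExpansion a (b - a)
  rw [add_sub_cancel, h] at hk
  exact ⟨k, by rw [hk]; ring⟩

theorem Matrix.dvd_det_of_row_sub {R m : Type*} [CommRing R] [Fintype m] [DecidableEq m]
    (M : Matrix m m R) (d : R) {i j : m} (hij : i ≠ j) (h : ∀ k, d ∣ M i k - M j k) :
    d ∣ M.det := by
  rw [← Ideal.mem_span_singleton, ← Ideal.Quotient.eq_zero_iff_mem, RingHom.map_det]
  refine Matrix.det_zero_of_row_eq hij (funext fun k => ?_)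
  simpa [Ideal.Quotient.eq, Ideal.mem_span_singleton] using h k

theorem totalDegree_det_le {σ m : Type*} [Fintype m] [DecidableEq m]
    (M : Matrix m m (MvPolynomial σ ℝ)) (d : m → ℕ) (h : ∀ i k, (M i k).totalDegree ≤ d k) :
    M.det.totalDegree ≤ ∑ k, d k := by
  rw [Matrix.det_apply]
  refine totalDegree_finsetSum_le fun g _ => ?_
  refine le_trans ?_ ((totalDegree_finsetProd Finset.univ fun k => M (g k) k).trans
    (Finset.sum_le_sum fun k _ => h (g k) k))
  rcases Int.units_eq_one_or (Equiv.Perm.sign g) with h | h <;> simp [h]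

theorem totalDegree_prod_of_ne_zero {σ ι : Type*} (s : Finset ι) (f : ι → MvPolynomial σ ℝ)
    (h : ∀ i ∈ s, f i ≠ 0) : (∏ i ∈ s, f i).totalDegree = ∑ i ∈ s, (f i).totalDegree := by
  classical
  induction s using Finset.induction_on with
  | empty => simp
  | insert a s ha ih =>
    rw [Finset.prod_insert ha, Finset.sum_insert ha, totalDegree_mul_of_isDomain
      (h a (by simp)) (Finset.prod_ne_zero_iff.2 fun i hi => h i (by simp [hi])),
      ih fun i hi => h i (by simp [hi])]

theorem finrank_restrictTotalDegree (n m : ℕ) :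
    Module.finrank ℝ (restrictTotalDegree (Fin n) ℝ m) = (m + n).choose n := by
  classical
  have e : {P : Fin (n + 1) → ℕ // ∑ i, P i = m} ≃
      {s : Fin n →₀ ℕ | (s.sum fun _ e => e) ≤ m} :=
    { toFun := fun P => ⟨Finsupp.equivFunOnFinite.symm (Fin.tail P.1), by
        have := P.2
        rw [Fin.sum_univ_succ] at this
        simp only [Set.mem_ofPred_eq]
        rw [Finsupp.sum_fintype _ _ (by simp)]
        simp only [Finsupp.equivFunOnFinite_symm_apply_apply, Fin.tail]
        omega⟩
      invFun := fun s => ⟨Fin.cons (m - s.1.sum fun _ e => e) s.1, by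
        have := s.2
        simp only [Set.mem_ofPred_eq] at this
        rw [Finsupp.sum_fintype _ _ (by simp)] at this ⊢
        rw [Fin.sum_univ_succ]
        simp only [Fin.cons_zero, Fin.cons_succ]
        omega⟩
      left_inv := fun P => by
        have := P.2
        rw [Fin.sum_univ_succ] at this
        apply Subtype.ext
        funext i
        refine Fin.cases ?_ (fun i => ?_) i
        · simp only [Fin.cons_zero]
          rw [Finsupp.sum_fintype _ _ (by simp)]
          simp only [Finsupp.equivFunOnFinite_symm_apply_apply, Fin.tail]
          omega
        · simp [Fin.tail]
      right_inv := fun s => by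
        apply Subtype.ext
        ext i
        simp }
  rw [restrictTotalDegree, Module.finrank_eq_nat_card_basis (basisRestrictSupport ℝ _),
    ← Nat.card_congr ((Sym.equivNatSumOfFintype (Fin (n + 1)) m).trans e),
    Nat.card_eq_fintype_card, Sym.card_sym_eq_choose, Fintype.card_fin,
    show n + 1 + m - 1 = m + n by omega, Nat.choose_symm_add]

theorem exists_generator_matrix {σ : Type*} {n : ℕ} (u : Fin (n + 1) → MvPolynomial σ ℝ)
    (hu : ∀ i, (u i).totalDegree ≤ 1) (hinj : Function.Injective u) :
    ∃ M : Matrix (Fin (n + 1)) (Fin (n + 1)) (MvPolynomial σ ℝ),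
      (∀ i k, (M i k).totalDegree ≤ if k = 0 then 0 else n + 1) ∧
      (∀ i j k, (u i - u j) ^ 2 ∣ M i k - M j k) ∧ M.det ≠ 0 := by
  classical
  set f : Fin (n + 1) → Polynomial (MvPolynomial σ ℝ) := fun k =>
    ∏ l ∈ Finset.univ.erase k, (Polynomial.X - Polynomial.C (u l)) with hf
  have hfdeg : ∀ k, JointDegreeLE n (f k) := fun k => by
    simpa using JointDegreeLE.prod_X_sub_C (Finset.univ.erase k) u hu
  have hfeval : ∀ k l, l ≠ k → (f k).eval (u l) = 0 := fun k l hlk => by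
    rw [hf, Polynomial.eval_prod]
    exact Finset.prod_eq_zero (Finset.mem_erase.2 ⟨hlk, Finset.mem_univ l⟩) (by simp)
  have hfself : ∀ k, (f k).eval (u k) ≠ 0 := fun k => by
    rw [hf, Polynomial.eval_prod]
    refine Finset.prod_ne_zero_iff.2 fun l hl => ?_
    simp only [Polynomial.eval_sub, Polynomial.eval_X, Polynomial.eval_C]
    exact sub_ne_zero.2 fun h => (Finset.mem_erase.1 hl).1 (hinj h).symm
  choose Φ hΦ hΦdeg using fun k => (hfdeg k).exists_derivative_eq
  refine ⟨Matrix.of fun i k => if k = 0 then 1 else (Φ k).eval (u i), fun i k => ?_,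
    fun i j k => ?_, ?_⟩
  · rw [Matrix.of_apply]
    split_ifs
    · simp
    · exact (hΦdeg k).totalDegree_eval_le (hu i)
  · simp only [Matrix.of_apply]
    split_ifs
    · simp
    rcases eq_or_ne i j with rfl | hij
    · simp
    rcases eq_or_ne j k with rfl | hjk
    · rw [← neg_sub (u j), neg_sq, ← neg_sub (Polynomial.eval (u j) _), dvd_neg]
      exact sq_dvd_eval_sub_eval (by rw [hΦ, hfeval _ _ hij])
    · exact sq_dvd_eval_sub_eval (by rw [hΦ, hfeval _ _ hjk])
  · rw [Ne, ← Matrix.exists_mulVec_eq_zero_iff]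
    rintro ⟨v, hv, hMv⟩
    set H := Polynomial.C (v 0) + ∑ k : Fin n, Polynomial.C (v k.succ) * Φ k.succ with hH
    have hHeval : ∀ i, H.eval (u i) = 0 := fun i => by
      have := congrFun hMv i
      simp only [Matrix.mulVec, Matrix.of_apply, dotProduct, Fin.sum_univ_succ, if_true, Fin.succ_ne_zero, if_false,
        one_mul, Pi.zero_apply] at this
      rw [← this, hH]
      simp [Polynomial.eval_finsetSum, mul_comm]
    have hH' : H.derivative = ∑ k : Fin n, Polynomial.C (v k.succ) * f k.succ := by
      rw [hH]
      simp [hΦ]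
    have hHdeg : H.natDegree ≤ n + 1 := by
      refine Polynomial.natDegree_add_le_of_degree_le (by simp)
        (Polynomial.natDegree_sum_le_of_forall_le _ _ fun k _ => ?_)
      exact (Polynomial.natDegree_C_mul_le _ _).trans (hΦdeg _).natDegree_le
    have hH0 : H = 0 := by
      obtain ⟨Q, hQ⟩ := Polynomial.dvd_iff_isRoot.2 (hHeval 0)
      have hQ0 : Q.eval (u 0) = 0 := by
        have h1 : H.derivative.eval (u 0) = 0 := by
          rw [hH', Polynomial.eval_finsetSum]
          refine Finset.sum_eq_zero fun k _ => ?_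
          rw [Polynomial.eval_mul, hfeval _ _ (Fin.succ_ne_zero k).symm, mul_zero]
        rw [hQ] at h1
        simpa using h1
      have hQi : ∀ i, Q.eval (u i) = 0 := fun i => by
        rcases eq_or_ne i 0 with rfl | hi
        · exact hQ0
        have h1 := hHeval i
        rw [hQ, Polynomial.eval_mul, mul_eq_zero] at h1
        refine h1.resolve_left ?_
        simpa [sub_eq_zero] using fun h => hi (hinj h)
      by_contra hne
      have hQne : Q ≠ 0 := fun h => hne (by rw [hQ, h, mul_zero])
      refine hQne (Polynomial.eq_zero_of_natDegree_lt_card_of_eval_eq_zero Q hinj hQi ?_)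
      rw [hQ, Polynomial.natDegree_mul (Polynomial.X_sub_C_ne_zero _) hQne,
        Polynomial.natDegree_X_sub_C] at hHdeg
      rw [Fintype.card_fin]
      omega
    have hvs : ∀ k : Fin n, v k.succ = 0 := fun k => by
      have h1 : H.derivative.eval (u k.succ) = 0 := by simp [hH0]
      rw [hH', Polynomial.eval_finsetSum, Finset.sum_eq_single k, Polynomial.eval_mul,
        Polynomial.eval_C, mul_eq_zero] at h1
      · exact h1.resolve_right (hfself _)
      · intro l _ hlk
        rw [Polynomial.eval_mul, hfeval _ _ fun h => hlk (Fin.succ_injective _ h).symm, mul_zero]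
      · simp
    refine hv (funext fun k => Fin.cases ?_ hvs k)
    rw [hH] at hH0
    simpa [hvs] using hH0

theorem sum_card_Ioi (n : ℕ) :
    ∑ i : Fin (n + 1), (Finset.Ioi i).card * 2 = n * (n + 1) := by
  simp only [Fin.card_Ioi]
  rw [← Finset.sum_mul, Fin.sum_univ_eq_sum_range (fun i => n + 1 - 1 - i) (n + 1),
    Finset.sum_range_reflect (fun i => i) (n + 1), Finset.sum_range_id_mul_two, mul_comm]
  simp

theorem exists_mulVec_eq {σ : Type*} {n r : ℕ} (u : Fin (n + 1) → MvPolynomial σ ℝ)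
    (hdeg : ∀ i j, i ≠ j → (u i - u j).totalDegree = 1)
    (hrel : ∀ i j k l, i < j → k < l → (i, j) ≠ (k, l) → IsRelPrime (u i - u j) (u k - u l))
    (M : Matrix (Fin (n + 1)) (Fin (n + 1)) (MvPolynomial σ ℝ))
    (hMdeg : ∀ i k, (M i k).totalDegree ≤ if k = 0 then 0 else n + 1)
    (hMdvd : ∀ i j k, (u i - u j) ^ 2 ∣ M i k - M j k) (hdet : M.det ≠ 0)
    (p : Fin (n + 1) → MvPolynomial σ ℝ) (hp : ∀ i, (p i).totalDegree ≤ r)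
    (hpdvd : ∀ i j, i ≠ j → (u i - u j) ^ 2 ∣ p i - p j) :
    ∃ q : Fin (n + 1) → MvPolynomial σ ℝ, M.mulVec q = p ∧
      ∀ k, q k ≠ 0 → (q k).totalDegree + (if k = 0 then 0 else n + 1) ≤ r := by
  classical
  set s : Finset (Σ _ : Fin (n + 1), Fin (n + 1)) := Finset.univ.sigma fun i => Finset.Ioi i with hs
  have hlt : ∀ a ∈ s, a.1 < a.2 := fun a ha => by simpa [hs] using ha
  set D := ∏ a ∈ s, (u a.1 - u a.2) ^ 2 with hD
  have hne : ∀ i j, i ≠ j → u i - u j ≠ 0 := fun i j hij h => by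
    simpa [h] using hdeg i j hij
  have hDdeg : D.totalDegree = n * (n + 1) := by
    have h1 : ∀ a ∈ s, ((u a.1 - u a.2) ^ 2).totalDegree = 2 := fun a ha => by
      have h2 := hne _ _ (hlt a ha).ne
      rw [sq, totalDegree_mul_of_isDomain h2 h2, hdeg _ _ (hlt a ha).ne]
    rw [hD, totalDegree_prod_of_ne_zero _ _ fun a ha => pow_ne_zero 2 (hne _ _ (hlt a ha).ne),
      Finset.sum_congr rfl h1, Finset.sum_const, smul_eq_mul, hs, Finset.card_sigma,
      Finset.sum_mul, sum_card_Ioi]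
  have hDdvd : ∀ N : Matrix (Fin (n + 1)) (Fin (n + 1)) (MvPolynomial σ ℝ),
      (∀ i j k, i ≠ j → (u i - u j) ^ 2 ∣ N i k - N j k) → D ∣ N.det := fun N hN => by
    refine Finset.prod_dvd_of_isRelPrime ?_ fun a ha =>
      N.dvd_det_of_row_sub _ (hlt a ha).ne fun k => hN _ _ k (hlt a ha).ne
    rintro ⟨i, j⟩ ha ⟨k, l⟩ hb hab
    refine (hrel i j k l (hlt _ ha) (hlt _ hb) fun h => hab ?_).pow
    simp only [Prod.mk.injEq] at h
    simp [h]
  obtain ⟨e, he⟩ := hDdvd M fun i j k _ => hMdvd i j k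
  have hD0 : D ≠ 0 := fun h => hdet (by rw [he, h, zero_mul])
  have he0 : e ≠ 0 := fun h => hdet (by rw [he, h, mul_zero])
  have hsum : ∑ k : Fin (n + 1), (if k = 0 then 0 else n + 1) = n * (n + 1) := by
    simp [Fin.sum_univ_succ, Fin.succ_ne_zero]
  have hec : e.totalDegree = 0 := by
    have h1 := totalDegree_det_le M _ hMdeg
    rw [he, totalDegree_mul_of_isDomain hD0 he0, hDdeg, hsum] at h1
    omega
  rw [totalDegree_eq_zero_iff_eq_C] at hec
  set c := coeff 0 e with hc
  have hc0 : c ≠ 0 := fun h => he0 (by rw [hec, h, C_0])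
  have hcr : ∀ k, D ∣ M.cramer p k := fun k => by
    rw [Matrix.cramer_apply]
    refine hDdvd _ fun i j l hij => ?_
    rcases eq_or_ne l k with rfl | hlk
    · simpa using hpdvd i j hij
    · simpa [Matrix.updateCol_apply, hlk] using hMdvd i j l
  choose h hh using hcr
  have hM : M.mulVec h = e • p := by
    have h1 := M.mulVec_cramer p
    have h2 : M.cramer p = D • h := funext hh
    rw [h2, Matrix.mulVec_smul, he, mul_smul] at h1
    exact smul_right_injective _ hD0 h1
  refine ⟨(C c⁻¹ : MvPolynomial σ ℝ) • h, ?_, fun k hk => ?_⟩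
  · rw [Matrix.mulVec_smul, hM, hec, smul_smul, ← C_mul, inv_mul_cancel₀ hc0, C_1, one_smul]
  · have hhk : h k ≠ 0 := fun h0 => hk (by simp [h0])
    have h1 : (M.cramer p k).totalDegree ≤
        ∑ l : Fin (n + 1), if l = k then r else if l = 0 then 0 else n + 1 := by
      rw [Matrix.cramer_apply]
      refine totalDegree_det_le _ _ fun i l => ?_
      rw [Matrix.updateCol_apply]
      split_ifs with h3 h4
      · exact hp i
      · simpa [h4] using hMdeg i l
      · simpa [h4] using hMdeg i l
    rw [hh, totalDegree_mul_of_isDomain hD0 hhk, hDdeg] at h1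
    rw [← Finset.add_sum_erase _ _ (Finset.mem_univ k)] at h1 hsum
    rw [Finset.sum_congr rfl fun l hl => if_neg (Finset.mem_erase.1 hl).1] at h1
    rw [if_pos rfl] at h1
    have h2 : (((C c⁻¹ : MvPolynomial σ ℝ) • h) k).totalDegree ≤ (h k).totalDegree := by
      rw [Pi.smul_apply, smul_eq_mul, C_mul']
      exact totalDegree_smul_le _ _
    omega

/-- The polynomial of degree at most one defining an affine function on `ℝⁿ`. -/
def affinePoly {n : ℕ} (f : (Fin n → ℝ) →ᵃ[ℝ] ℝ) : MvPolynomial (Fin n) ℝ :=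
  C (f 0) + ∑ c, C (f.linear fun d => if c = d then 1 else 0) * X c

theorem eval_affinePoly {n : ℕ} (f : (Fin n → ℝ) →ᵃ[ℝ] ℝ) (y : Fin n → ℝ) :
    eval y (affinePoly f) = f y := by
  have h : f y = f.linear y + f 0 := congrFun f.decomp y
  rw [h, affinePoly, LinearMap.pi_apply_eq_sum_univ f.linear y]
  simp [mul_comm, add_comm]

theorem totalDegree_affinePoly_le {n : ℕ} (f : (Fin n → ℝ) →ᵃ[ℝ] ℝ) :
    (affinePoly f).totalDegree ≤ 1 := by
  refine (totalDegree_add _ _).trans (max_le (by simp) (totalDegree_finsetSum_le fun c _ => ?_))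
  rw [C_mul']
  exact (totalDegree_smul_le _ _).trans (by simp)

theorem pderiv_affinePoly {n : ℕ} (f : (Fin n → ℝ) →ᵃ[ℝ] ℝ) (c : Fin n) :
    pderiv c (affinePoly f) = C (f.linear fun d => if c = d then 1 else 0) := by
  classical
  simp [affinePoly, pderiv_X, Pi.single_apply]

theorem affinePoly_sub {n : ℕ} (f g : (Fin n → ℝ) →ᵃ[ℝ] ℝ) :
    affinePoly (f - g) = affinePoly f - affinePoly g :=
  MvPolynomial.funext fun y => by simp [eval_affinePoly]

theorem affinePoly_dvd_of_eval_eq_zero {n : ℕ} {f : (Fin n → ℝ) →ᵃ[ℝ] ℝ} {w : Fin n → ℝ}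
    (hw : f.linear w = 1) {g : MvPolynomial (Fin n) ℝ}
    (hg : ∀ y, f y = 0 → eval y g = 0) : affinePoly f ∣ g := by
  set θ : MvPolynomial (Fin n) ℝ →ₐ[ℝ] MvPolynomial (Fin n) ℝ :=
    aeval fun c => X c - affinePoly f * C (w c) with hθ
  have h0 : θ g = 0 := MvPolynomial.funext fun y => by
    have h1 : eval y (θ g) = eval (y - f y • w) g := by
      have h2 : (aeval y).comp θ = aeval (y - f y • w) :=
        MvPolynomial.algHom_ext fun c => by simp [hθ, aeval_eq_eval, eval_affinePoly]
      simpa [aeval_eq_eval] using DFunLike.congr_fun h2 g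
    rw [h1, map_zero]
    apply hg
    have h2 := f.map_vadd y (-(f y • w))
    rw [vadd_eq_add, vadd_eq_add, neg_add_eq_sub] at h2
    rw [h2, map_neg, map_smul, hw]
    simp
  have h1 : (Ideal.Quotient.mkₐ ℝ (Ideal.span {affinePoly f})).comp θ =
      Ideal.Quotient.mkₐ ℝ (Ideal.span {affinePoly f}) := by
    refine MvPolynomial.algHom_ext fun c => ?_
    simp only [hθ, AlgHom.comp_apply, aeval_X]
    rw [← sub_eq_zero, ← map_sub, Ideal.Quotient.mkₐ_eq_mk, Ideal.Quotient.eq_zero_iff_mem,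
      Ideal.mem_span_singleton]
    exact ⟨-C (w c), by ring⟩
  have h2 := DFunLike.congr_fun h1 g
  rw [AlgHom.comp_apply, h0, map_zero, eq_comm, Ideal.Quotient.mkₐ_eq_mk,
    Ideal.Quotient.eq_zero_iff_mem, Ideal.mem_span_singleton] at h2
  exact h2

section Simplex

variable {n : ℕ} {x : Fin (n + 1) → (Fin n → ℝ)}

theorem exists_affineBasis_coe_eq (hx : AffineIndependent ℝ x) :
    ∃ b : AffineBasis (Fin (n + 1)) ℝ (Fin n → ℝ), ∀ i, b i = x i :=
  ⟨⟨x, hx, hx.affineSpan_eq_top_iff_card_eq_finrank_add_one.2 (by simp)⟩, fun _ => rfl⟩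

variable (b : AffineBasis (Fin (n + 1)) ℝ (Fin n → ℝ))

theorem coord_bary (i : Fin (n + 1)) : b.coord i (bary n b) = ((n : ℝ) + 1)⁻¹ := by
  have h1 : bary n b = Finset.univ.affineCombination ℝ b fun _ => ((n : ℝ) + 1)⁻¹ := by
    rw [Finset.affineCombination_eq_linear_combination, bary, Finset.smul_sum]
    simp [mul_inv_cancel₀ (by positivity : (n : ℝ) + 1 ≠ 0)]
  rw [h1, b.coord_apply_combination_of_mem (Finset.mem_univ i)]
  simp [mul_inv_cancel₀ (by positivity : (n : ℝ) + 1 ≠ 0)]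

theorem coord_eq_of_mem_intFace {i j : Fin (n + 1)} {y : Fin n → ℝ}
    (hy : y ∈ intFace n b i j) : b.coord i y = b.coord j y := by
  have hconv : Convex ℝ ((b.coord i - b.coord j) ⁻¹' {0}) :=
    (convex_singleton (0 : ℝ)).affine_preimage _
  have hsub : insert (bary n b) (b '' {k | k ≠ i ∧ k ≠ j}) ⊆
      (b.coord i - b.coord j) ⁻¹' {0} := by
    rintro _ (rfl | ⟨k, hk, rfl⟩)
    · simp [coord_bary]
    · simp [b.coord_apply_ne hk.1.symm, b.coord_apply_ne hk.2.symm]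
  have h := convexHull_min hsub hconv hy
  simpa [sub_eq_zero] using h

theorem mem_intFace_of_coord {i j : Fin (n + 1)} {y : Fin n → ℝ}
    (hij : b.coord i y = b.coord j y) (hi : 0 ≤ b.coord i y)
    (hk : ∀ k, b.coord i y ≤ b.coord k y) : y ∈ intFace n b i j := by
  classical
  set β := b.coord i y with hβ
  have hsum := b.sum_coord_apply_eq_one y
  have hn : (n : ℝ) + 1 ≠ 0 := by positivity
  have hz : ((n : ℝ) + 1) • bary n b = ∑ k, b k := by
    rw [bary, smul_smul, mul_inv_cancel₀ hn, one_smul]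
  set v : Fin (n + 1) → (Fin n → ℝ) := fun k => if k = i ∨ k = j then bary n b else b k with hv
  set w : Fin (n + 1) → ℝ := fun k =>
    (b.coord k y - β) + if k = i then ((n : ℝ) + 1) * β else 0 with hw
  have key : ∑ k, w k • v k = y := by
    have h1 : ∀ k, w k • v k = b.coord k y • b k - β • b k +
        if k = i then β • ((n : ℝ) + 1) • bary n b else 0 := fun k => by
      by_cases h2 : k = i
      · subst h2
        simp [hw, hv, ← hβ, smul_smul, mul_comm]
      · by_cases h3 : k = j
        · subst h3
          simp [hw, hv, h2, ← hij]
        · simp [hw, hv, h2, h3, sub_smul]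
    rw [Finset.sum_congr rfl fun k _ => h1 k, Finset.sum_add_distrib, Finset.sum_sub_distrib,
      b.linear_combination_coord_eq_self, ← Finset.smul_sum, Finset.sum_ite_eq', if_pos (by simp),
      hz, sub_add_cancel]
  rw [← key]
  refine (convex_convexHull ℝ _).sum_mem (fun k _ => ?_) ?_ fun k _ => subset_convexHull ℝ _ ?_
  · have := hk k
    have : 0 ≤ ((n : ℝ) + 1) * β := by positivity
    simp only [hw]
    split_ifs <;> linarith
  · simp only [hw, Finset.sum_add_distrib, Finset.sum_sub_distrib, hsum, Finset.sum_ite_eq',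
      Finset.mem_univ, if_true, Finset.sum_const, Finset.card_univ, Fintype.card_fin, nsmul_eq_mul]
    push_cast
    ring
  · simp only [hv]
    split_ifs with h
    · exact Set.mem_insert _ _
    · exact Set.mem_insert_of_mem _ ⟨k, by simpa [not_or] using h, rfl⟩

theorem exists_interior_point_intFace (i j : Fin (n + 1)) :
    ∃ a, b.coord i a = b.coord j a ∧ 0 < b.coord i a ∧
      ∀ k, k ≠ i → k ≠ j → b.coord i a < b.coord k a := by
  classical
  set t : ℝ := ∑ k : Fin (n + 1), if k = i ∨ k = j then 1 else 2 with ht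
  have ht0 : 0 < t := Finset.sum_pos (fun k _ => by split_ifs <;> norm_num) ⟨i, by simp⟩
  set w : Fin (n + 1) → ℝ := fun k => t⁻¹ * if k = i ∨ k = j then 1 else 2 with hw
  have hw1 : Finset.univ.sum w = 1 := by
    rw [hw, ← Finset.mul_sum, ← ht, inv_mul_cancel₀ ht0.ne']
  have hc : ∀ k, b.coord k (Finset.univ.affineCombination ℝ b w) = w k := fun k =>
    b.coord_apply_combination_of_mem (Finset.mem_univ k) hw1
  refine ⟨Finset.univ.affineCombination ℝ b w, ?_, ?_, fun k h1 h2 => ?_⟩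
  · rw [hc, hc]
    simp [hw]
  · rw [hc]
    simpa [hw] using ht0
  · rw [hc, hc]
    have := inv_pos.2 ht0
    simp only [hw, h1, h2, true_or, or_self, if_true, if_false]
    linarith

theorem eval_eq_zero_of_forall_mem_intFace {i j : Fin (n + 1)} {g : MvPolynomial (Fin n) ℝ}
    (hg : ∀ y ∈ intFace n b i j, eval y g = 0) {y : Fin n → ℝ}
    (hy : b.coord i y = b.coord j y) : eval y g = 0 := by
  obtain ⟨a, ha, ha0, hak⟩ := exists_interior_point_intFace b i j
  set G : Polynomial ℝ :=
    aeval (fun c => Polynomial.C (a c) + Polynomial.X * Polynomial.C (y c - a c)) g with hG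
  have hGeval : ∀ t, G.eval t = eval (AffineMap.lineMap a y t) g := fun t => by
    have h1 : (Polynomial.aeval t).comp
        (aeval fun c => Polynomial.C (a c) + Polynomial.X * Polynomial.C (y c - a c)) =
        (aeval (AffineMap.lineMap a y t : Fin n → ℝ) : MvPolynomial (Fin n) ℝ →ₐ[ℝ] ℝ) :=
      MvPolynomial.algHom_ext fun c => by
        simp [AffineMap.lineMap_apply]
        ring
    have h2 := DFunLike.congr_fun h1 g
    simpa [hG, Polynomial.aeval_def, Polynomial.eval₂_eq_eval_map, aeval_eq_eval] using h2
  have hcoord : ∀ k t, b.coord k (AffineMap.lineMap a y t) =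
      b.coord k a + t * (b.coord k y - b.coord k a) := fun k t => by
    rw [AffineMap.apply_lineMap, AffineMap.lineMap_apply, vsub_eq_sub, smul_eq_mul, vadd_eq_add,
      add_comm]
  have hev : ∀ c d : ℝ, 0 < c → ∀ᶠ t in nhds (0 : ℝ), 0 < c + t * d := fun c d hc => by
    have h1 : ContinuousAt (fun t : ℝ => c + t * d) 0 := by fun_prop
    exact continuousAt_const.eventually_lt h1 (by simpa using hc)
  have hface : ∀ᶠ t in nhds (0 : ℝ), (AffineMap.lineMap a y t : Fin n → ℝ) ∈ intFace n b i j := by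
    have h1 : ∀ k, ∀ᶠ t in nhds (0 : ℝ), k ≠ i → k ≠ j →
        0 < (b.coord k a - b.coord i a) +
          t * ((b.coord k y - b.coord k a) - (b.coord i y - b.coord i a)) := fun k => by
      by_cases h2 : k ≠ i ∧ k ≠ j
      · filter_upwards [hev _ _ (sub_pos.2 (hak k h2.1 h2.2))] with t ht _ _ using ht
      · exact Filter.Eventually.of_forall fun t h3 h4 => absurd ⟨h3, h4⟩ h2
    filter_upwards [hev _ (b.coord i y - b.coord i a) ha0, Filter.eventually_all.2 h1]
      with t ht0 ht
    refine mem_intFace_of_coord b ?_ ?_ fun k => ?_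
    · rw [hcoord, hcoord, ha, hy]
    · rw [hcoord]
      exact ht0.le
    · rw [hcoord, hcoord]
      rcases eq_or_ne k i with rfl | hki
      · exact le_rfl
      rcases eq_or_ne k j with rfl | hkj
      · rw [ha, hy]
      · have := ht k hki hkj
        linarith
  have hG0 : G = 0 := Polynomial.eq_zero_of_infinite_isRoot G <|
    infinite_of_mem_nhds (0 : ℝ) <| by
      filter_upwards [hface] with t ht
      simpa [hGeval] using hg _ ht
  have h1 := hGeval 1
  rw [AffineMap.lineMap_apply_one, hG0, Polynomial.eval_zero] at h1
  exact h1.symm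

theorem totalDegree_affinePoly_coord_sub {i j : Fin (n + 1)} (hij : i ≠ j) :
    (affinePoly (b.coord i) - affinePoly (b.coord j)).totalDegree = 1 := by
  rw [← affinePoly_sub]
  refine le_antisymm (totalDegree_affinePoly_le _) (Nat.one_le_iff_ne_zero.2 fun h => ?_)
  rw [totalDegree_eq_zero_iff_eq_C] at h
  have h1 := congrArg (eval (b i)) h
  have h2 := congrArg (eval (b j)) h
  rw [eval_C, eval_affinePoly] at h1 h2
  rw [← h2] at h1
  have h3 : (1 : ℝ) = -1 := by
    simpa [b.coord_apply_ne hij, b.coord_apply_ne hij.symm] using h1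
  norm_num at h3

theorem dvd_of_eval_eq_zero_on_intFace {i j : Fin (n + 1)} (hij : i ≠ j)
    {g : MvPolynomial (Fin n) ℝ} (hg : ∀ y ∈ intFace n b i j, eval y g = 0) :
    affinePoly (b.coord i) - affinePoly (b.coord j) ∣ g := by
  rw [← affinePoly_sub]
  refine affinePoly_dvd_of_eval_eq_zero (w := (2⁻¹ : ℝ) • (b i - b j)) ?_ fun y hy =>
    eval_eq_zero_of_forall_mem_intFace b hg (by simpa [sub_eq_zero] using hy)
  have h := (b.coord i - b.coord j).linearMap_vsub (b i) (b j)
  rw [vsub_eq_sub] at h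
  rw [map_smul, h]
  simp [b.coord_apply_ne hij, b.coord_apply_ne hij.symm]
  norm_num

theorem sq_dvd_iff_C1_on_intFace {i j : Fin (n + 1)} (hij : i ≠ j)
    (g : MvPolynomial (Fin n) ℝ) :
    (affinePoly (b.coord i) - affinePoly (b.coord j)) ^ 2 ∣ g ↔
      ∀ y ∈ intFace n b i j, eval y g = 0 ∧ ∀ c, eval y (pderiv c g) = 0 := by
  set L := affinePoly (b.coord i) - affinePoly (b.coord j) with hL
  have hL0 : ∀ y ∈ intFace n b i j, eval y L = 0 := fun y hy => by
    rw [hL, map_sub, eval_affinePoly, eval_affinePoly, coord_eq_of_mem_intFace b hy, sub_self]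
  constructor
  · rintro ⟨h, rfl⟩ y hy
    refine ⟨by simp [hL0 y hy], fun c => ?_⟩
    simp [Derivation.leibniz, Derivation.leibniz_pow, hL0 y hy]
  · intro hg
    obtain ⟨h, rfl⟩ := dvd_of_eval_eq_zero_on_intFace b hij fun y hy => (hg y hy).1
    rw [← hL] at hg ⊢
    obtain ⟨c, a, ha, hc⟩ : ∃ (c : Fin n) (a : ℝ), a ≠ 0 ∧ pderiv c L = C a := by
      by_contra! hcon
      have hdeg : L.totalDegree = 1 := totalDegree_affinePoly_coord_sub b hij
      rw [hL, ← affinePoly_sub] at hcon hdeg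
      have h0 : ∀ c, ((b.coord i - b.coord j).linear fun d => if c = d then 1 else 0) = 0 :=
        fun c => by
          by_contra hne
          exact hcon c _ hne (pderiv_affinePoly _ c)
      simp only [affinePoly, h0, C_0, zero_mul, Finset.sum_const_zero, add_zero,
        totalDegree_C, zero_ne_one] at hdeg
    rw [sq]
    refine mul_dvd_mul_left L (dvd_of_eval_eq_zero_on_intFace b hij fun y hy => ?_)
    have h1 := (hg y hy).2 c
    rw [Derivation.leibniz, hc] at h1
    simpa [hL0 y hy, ha] using h1

theorem isRelPrime_affinePoly_coord_sub {i j k l : Fin (n + 1)} (hij : i < j) (hkl : k < l)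
    (hne : (i, j) ≠ (k, l)) :
    IsRelPrime (affinePoly (b.coord i) - affinePoly (b.coord j))
      (affinePoly (b.coord k) - affinePoly (b.coord l)) := by
  have hdeg := totalDegree_affinePoly_coord_sub b hij.ne
  have hirr := irreducible_of_totalDegree_eq_one hdeg fun a ha => by
    refine isUnit_iff_ne_zero.2 fun h0 => ?_
    simp only [h0, zero_dvd_iff] at ha
    rw [MvPolynomial.ext _ 0 fun m => (ha m).trans (coeff_zero m).symm] at hdeg
    simp at hdeg
  refine hirr.isRelPrime_iff_not_dvd.2 ?_
  rintro ⟨q, hq⟩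
  obtain ⟨m, hmi, hmj, hm⟩ : ∃ m, i ≠ m ∧ j ≠ m ∧ (m = k ∨ m = l) := by
    by_contra! hcon
    have h1 := hcon k
    have h2 := hcon l
    rw [ne_eq, Prod.mk.injEq] at hne
    grind
  have h := congrArg (eval (b m)) hq
  simp only [map_mul, map_sub, eval_affinePoly, b.coord_apply_ne hmi, b.coord_apply_ne hmj] at h
  rcases hm with rfl | rfl
  · simp [b.coord_apply_ne hkl.ne'] at h
  · simp [b.coord_apply_ne hkl.ne] at h

theorem mem_C1Space_iff {r : ℕ} (p : Fin (n + 1) → MvPolynomial (Fin n) ℝ) :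
    p ∈ C1Space n r b ↔ (∀ i, (p i).totalDegree ≤ r) ∧
      ∀ i j, i ≠ j → (affinePoly (b.coord i) - affinePoly (b.coord j)) ^ 2 ∣ p i - p j := by
  refine and_congr_right fun _ => forall₃_congr fun i j hij => ?_
  rw [sq_dvd_iff_C1_on_intFace b hij]
  simp [sub_eq_zero]

end Simplex

/-- The polynomials `q` with `q = 0` or `deg q + d ≤ r`. -/
def shiftedDegreeLE (n r d : ℕ) : Submodule ℝ (MvPolynomial (Fin n) ℝ) :=
  if d ≤ r then restrictTotalDegree (Fin n) ℝ (r - d) else ⊥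

theorem mem_shiftedDegreeLE {n r d : ℕ} {q : MvPolynomial (Fin n) ℝ} :
    q ∈ shiftedDegreeLE n r d ↔ (q ≠ 0 → q.totalDegree + d ≤ r) := by
  rw [shiftedDegreeLE]
  split_ifs with h
  · rw [mem_restrictTotalDegree]
    refine ⟨fun h1 _ => by omega, fun h1 => ?_⟩
    by_cases hq : q = 0
    · simp [hq]
    · have := h1 hq
      omega
  · rw [Submodule.mem_bot]
    refine ⟨fun h1 h2 => absurd h1 h2, fun h1 => ?_⟩
    by_contra hq
    have := h1 hq
    omega

instance (n r d : ℕ) : Module.Finite ℝ (shiftedDegreeLE n r d) := by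
  by_cases h : d ≤ r
  · rw [shiftedDegreeLE, if_pos h]
    infer_instance
  · rw [shiftedDegreeLE, if_neg h]
    infer_instance

theorem finrank_shiftedDegreeLE_zero (n r : ℕ) :
    Module.finrank ℝ (shiftedDegreeLE n r 0) = (r + n).choose n := by
  rw [shiftedDegreeLE, if_pos (Nat.zero_le r), finrank_restrictTotalDegree, Nat.sub_zero]

theorem finrank_shiftedDegreeLE_succ {n : ℕ} (hn : 0 < n) (r : ℕ) :
    Module.finrank ℝ (shiftedDegreeLE n r (n + 1)) = (r - 1).choose n := by
  by_cases h : n + 1 ≤ r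
  · rw [shiftedDegreeLE, if_pos h, finrank_restrictTotalDegree]
    congr 1
    omega
  · rw [shiftedDegreeLE, if_neg h, finrank_bot, Nat.choose_eq_zero_of_lt (by omega)]

/-- the space of `C¹` piecewise polynomials of degree at most `r` on the Alfeld
split of an `n`-simplex has dimension `C(r+n, n) + n * C(r-1, n)`. -/
theorem statement13 (n r : ℕ) (hn : 2 ≤ n)
    (x : Fin (n + 1) → (Fin n → ℝ)) (hx : AffineIndependent ℝ x) :
    Module.finrank ℝ (C1Space n r x) =
      Nat.choose (r + n) n + n * Nat.choose (r - 1) n := by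
  obtain ⟨b, hb⟩ := exists_affineBasis_coe_eq hx
  obtain rfl : ⇑b = x := funext hb
  set u : Fin (n + 1) → MvPolynomial (Fin n) ℝ := fun i => affinePoly (b.coord i) with hu
  have hudeg : ∀ i j, i ≠ j → (u i - u j).totalDegree = 1 := fun i j hij =>
    totalDegree_affinePoly_coord_sub b hij
  have hinj : Function.Injective u := fun i j hij => by
    by_contra hne
    simpa [hij] using hudeg i j hne
  obtain ⟨M, hMdeg, hMdvd, hdet⟩ :=
    exists_generator_matrix u (fun i => totalDegree_affinePoly_le _) hinj
  let d : Fin (n + 1) → ℕ := fun k => if k = 0 then 0 else n + 1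
  let F : (∀ k, shiftedDegreeLE n r (d k)) →ₗ[ℝ] Fin (n + 1) → MvPolynomial (Fin n) ℝ :=
    (M.mulVecLin.restrictScalars ℝ).comp
      (LinearMap.pi fun k => (shiftedDegreeLE n r (d k)).subtype.comp (LinearMap.proj k))
  have hF : ∀ q, F q = M.mulVec fun k => (q k : MvPolynomial (Fin n) ℝ) := fun _ => rfl
  have hFinj : Function.Injective F := by
    rw [← LinearMap.ker_eq_bot, LinearMap.ker_eq_bot']
    intro q hq
    have h := Matrix.eq_zero_of_mulVec_eq_zero hdet ((hF q).symm.trans hq)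
    exact funext fun k => Subtype.ext (congrFun h k)
  have hrange : LinearMap.range F = C1Space n r b := by
    ext p
    rw [mem_C1Space_iff]
    constructor
    · rintro ⟨q, rfl⟩
      rw [hF]
      refine ⟨fun i => totalDegree_finsetSum_le fun k _ => ?_, fun i j _ => ?_⟩
      · by_cases hq : (q k : MvPolynomial (Fin n) ℝ) = 0
        · simp [hq]
        · have h1 := mem_shiftedDegreeLE.1 (q k).2 hq
          have h2 := totalDegree_mul (M i k) (q k)
          have h3 : (M i k).totalDegree ≤ d k := hMdeg i k
          exact h2.trans (by omega)
      · simp only [Matrix.mulVec, dotProduct, ← Finset.sum_sub_distrib, ← sub_mul]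
        exact Finset.dvd_sum fun k _ => (hMdvd i j k).mul_right _
    · rintro ⟨hp, hpdvd⟩
      obtain ⟨q, hq, hqdeg⟩ := exists_mulVec_eq u hudeg
        (fun i j k l hij hkl hne => isRelPrime_affinePoly_coord_sub b hij hkl hne)
        M hMdeg hMdvd hdet p hp hpdvd
      exact ⟨fun k => ⟨q k, mem_shiftedDegreeLE.2 (hqdeg k)⟩, hq⟩
  rw [← hrange, LinearMap.finrank_range_of_inj hFinj, Module.finrank_pi_fintype,
    Fin.sum_univ_succ]
  have h0 : Module.finrank ℝ (shiftedDegreeLE n r (d 0)) = (r + n).choose n :=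
    finrank_shiftedDegreeLE_zero n r
  have hs : ∀ k : Fin n, Module.finrank ℝ (shiftedDegreeLE n r (d k.succ)) = (r - 1).choose n :=
    fun _ => finrank_shiftedDegreeLE_succ (by omega) r
  rw [h0, Finset.sum_congr rfl fun k _ => hs k]
  simp
end
end

section
/- Let r ≥ 1 be an integer. The real vector space of piecewise polynomial vector fields (p₀,p₁,p₂,p₃) of degree ≤ r on the Alfeld split T^z of a tetrahedron T ⊂ ℝ³ such that both p and curl p are continuous across interior faces (p_i = p_j and curl p_i = curl p_j at every point of F_{ij} for all i ≠ j) has dimension r(2r² − 3r + 13). -/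
open MvPolynomial Matrix

noncomputable section

namespace Alfeld

abbrev V3 : Type := Fin 3 → ℝ
abbrev P3 : Type := MvPolynomial (Fin 3) ℝ
abbrev VP3 : Type := Fin 3 → P3

/-- Cross product of vectors in `ℝ³`. -/
def cross3 (u v : V3) : V3 := fun c => u (c + 1) * v (c + 2) - u (c + 2) * v (c + 1)

/-- Evaluation of a polynomial vector field at a point. -/
def evalV (p : VP3) (y : V3) : V3 := fun c => eval y (p c)

/-- Gradient of a polynomial. -/
def pgrad (q : P3) : VP3 := fun c => pderiv c q

/-- Curl of a polynomial vector field. -/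
def pcurl (p : VP3) : VP3 := fun c => pderiv (c + 1) (p (c + 2)) - pderiv (c + 2) (p (c + 1))

/-- Divergence of a polynomial vector field. -/
def pdiv (p : VP3) : P3 := ∑ c, pderiv c (p c)

/-- Cross product of polynomial vector fields. -/
def pcross (u v : VP3) : VP3 := fun c => u (c + 1) * v (c + 2) - u (c + 2) * v (c + 1)

/-- All components have total degree at most `r`. -/
def degVle (p : VP3) (r : ℕ) : Prop := ∀ c, (p c).totalDegree ≤ r

/-- Barycenter of the tetrahedron with vertices `x 0, x 1, x 2, x 3`. -/
def bary (x : Fin 4 → V3) : V3 := (4 : ℝ)⁻¹ • (x 0 + x 1 + x 2 + x 3)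

/-- The piece `T_i` of the Alfeld split. -/
def piece (x : Fin 4 → V3) (i : Fin 4) : Set V3 :=
  convexHull ℝ (insert (bary x) (x '' {j | j ≠ i}))

/-- The interior face `F_{ij} = T_i ∩ T_j`. -/
def intFace (x : Fin 4 → V3) (i j : Fin 4) : Set V3 :=
  convexHull ℝ (insert (bary x) (x '' {k | k ≠ i ∧ k ≠ j}))

/-- The boundary face of `T` opposite the vertex `x i`. -/
def bdryFace (x : Fin 4 → V3) (i : Fin 4) : Set V3 :=
  convexHull ℝ (x '' {j | j ≠ i})

/-- `n` is a (Euclidean) unit normal of the interior face `F_{ij}`. -/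
def IsUnitNormalInt (x : Fin 4 → V3) (i j : Fin 4) (n : V3) : Prop :=
  n ⬝ᵥ n = 1 ∧ ∀ k, k ≠ i → k ≠ j → n ⬝ᵥ (x k - bary x) = 0

/-- `n` is a (Euclidean) unit normal of the boundary face `F_i`. -/
def IsUnitNormalBdry (x : Fin 4 → V3) (i : Fin 4) (n : V3) : Prop :=
  n ⬝ᵥ n = 1 ∧ ∀ j k, j ≠ i → k ≠ i → n ⬝ᵥ (x k - x j) = 0

/-- The vertices of the Alfeld split. -/
def vertices (x : Fin 4 → V3) : Set V3 := insert (bary x) (Set.range x)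

/-- Jacobian matrix of a polynomial vector field at a point. -/
def jacob (p : VP3) (a : V3) : Fin 3 → Fin 3 → ℝ := fun c d => eval a (pderiv d (p c))

end Alfeld

open Alfeld

namespace Alfeld

lemma pcurl_add (a b : VP3) : pcurl (a + b) = pcurl a + pcurl b := by
  funext c
  simp only [pcurl, Pi.add_apply, map_add]
  ring

lemma pcurl_smul (s : ℝ) (a : VP3) : pcurl (s • a) = s • pcurl a := by
  funext c
  simp only [pcurl, Pi.smul_apply, Derivation.map_smul, smul_sub]

lemma pcurl_zero : pcurl (0 : VP3) = 0 := by
  funext c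
  simp [pcurl]

/-- The space of piecewise polynomial vector fields of degree at most `r` on the Alfeld
split of the tetrahedron with vertices `x 0, …, x 3` such that both the field and its curl
are continuous across the interior faces. -/
def H1CurlSpace (r : ℕ) (x : Fin 4 → V3) : Submodule ℝ (Fin 4 → VP3) where
  carrier := {p | (∀ i, degVle (p i) r) ∧
    ∀ i j, i ≠ j → ∀ y ∈ intFace x i j,
      evalV (p i) y = evalV (p j) y ∧ evalV (pcurl (p i)) y = evalV (pcurl (p j)) y}
  add_mem' := by
    intro a b ha hb
    obtain ⟨ha1, ha2⟩ := ha
    obtain ⟨hb1, hb2⟩ := hb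
    constructor
    · intro i c
      exact (totalDegree_add (a i c) (b i c)).trans (max_le (ha1 i c) (hb1 i c))
    · intro i j hij y hy
      obtain ⟨h1, h2⟩ := ha2 i j hij y hy
      obtain ⟨h3, h4⟩ := hb2 i j hij y hy
      have hab : ∀ k : Fin 4, (a + b) k = a k + b k := fun _ => rfl
      constructor
      · funext c
        have e1 := congrFun h1 c
        have e3 := congrFun h3 c
        simp only [hab, evalV, Pi.add_apply, map_add]
        simp only [evalV] at e1 e3
        rw [e1, e3]
      · funext c
        have e2 := congrFun h2 c
        have e4 := congrFun h4 c
        simp only [hab, pcurl_add, evalV, Pi.add_apply, map_add]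
        simp only [evalV] at e2 e4
        rw [e2, e4]
  zero_mem' := by
    constructor
    · intro i c
      simp [degVle]
    · intro i j hij y hy
      constructor
      · rfl
      · show evalV (pcurl ((0 : Fin 4 → VP3) i)) y = evalV (pcurl ((0 : Fin 4 → VP3) j)) y
        rfl
  smul_mem' := by
    intro s a ha
    obtain ⟨ha1, ha2⟩ := ha
    constructor
    · intro i c
      exact (totalDegree_smul_le s (a i c)).trans (ha1 i c)
    · intro i j hij y hy
      obtain ⟨h1, h2⟩ := ha2 i j hij y hy
      have hsa : ∀ k : Fin 4, (s • a) k = s • a k := fun _ => rfl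
      constructor
      · funext c
        have e1 := congrFun h1 c
        simp only [hsa, evalV, Pi.smul_apply, smul_eval]
        simp only [evalV] at e1
        rw [e1]
      · funext c
        have e2 := congrFun h2 c
        simp only [hsa, pcurl_smul, evalV, Pi.smul_apply, smul_eval]
        simp only [evalV] at e2
        rw [e2]

end Alfeld

open Alfeld

namespace Alfeld

/-- Polynomials in the four Courant functions of the Alfeld split. -/
abbrev Q4 : Type := MvPolynomial (Fin 4) ℝ

/-- The derivation `∑ ∂/∂y_n`. -/
def sumD : Derivation ℝ Q4 Q4 := ∑ n, pderiv n

lemma sumD_apply (F : Q4) : sumD F = ∑ n, pderiv n F := by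
  simp [sumD, Fin.sum_univ_four]

lemma sumD_C (a : ℝ) : sumD (C a) = 0 := sumD.map_algebraMap a

lemma sumD_X (n : Fin 4) : sumD (X n) = 1 := by
  rw [sumD_apply, Finset.sum_eq_single n]
  · simp
  · intro m _ h
    exact pderiv_X_of_ne h.symm
  · simp

lemma coeff_sumD (F : Q4) (β : Fin 4 →₀ ℕ) :
    coeff β (sumD F) = ∑ n, coeff (β + Finsupp.single n 1) F * (β n + 1) := by
  simp [sumD_apply, coeff_sum, coeff_pderiv]

/-- Representatives of continuous splines of degree at most `r`. -/
def contSpace (r : ℕ) : Submodule ℝ Q4 :=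
  restrictSupport ℝ {α | α.degree ≤ r ∧ ∃ i, α i = 0}

lemma mem_contSpace {r : ℕ} {F : Q4} :
    F ∈ contSpace r ↔ ∀ α, coeff α F ≠ 0 → α.degree ≤ r ∧ ∃ i, α i = 0 := by
  simp [contSpace, mem_restrictSupport_iff, Set.subset_def]

/-- Exponents supported on a two-element set containing `k`. -/
def NearRay (k : Fin 4) (β : Fin 4 →₀ ℕ) : Prop :=
  ∃ i j, i ≠ j ∧ i ≠ k ∧ j ≠ k ∧ β i = 0 ∧ β j = 0

/-- Polynomials vanishing on every coordinate plane through the `k`-th coordinate axis. -/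
def vanishNear (k : Fin 4) : Submodule ℝ Q4 where
  carrier := {G | ∀ β, NearRay k β → coeff β G = 0}
  add_mem' ha hb β h := by rw [coeff_add, ha β h, hb β h, add_zero]
  zero_mem' _ _ := coeff_zero _
  smul_mem' s G h β hβ := by rw [coeff_smul, h β hβ, smul_zero]

lemma mem_vanishNear {k : Fin 4} {G : Q4} :
    G ∈ vanishNear k ↔ ∀ β, NearRay k β → coeff β G = 0 := Iff.rfl

lemma mul_X_mul_X_mem_vanishNear {k i j : Fin 4} (hij : i ≠ j) (hi : i ≠ k) (hj : j ≠ k)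
    (P : Q4) : P * (X i * X j) ∈ vanishNear k := by
  rintro β ⟨a, b, hab, ha, hb, h1, h2⟩
  have h : β i = 0 ∨ β j = 0 := by
    have : a = i ∨ b = i ∨ a = j ∨ b = j := by omega
    rcases this with rfl | rfl | rfl | rfl <;> simp [*]
  rcases h with h | h
  · rw [show P * (X i * X j) = (P * X j) * X i by ring, coeff_mul_X']
    simp [h]
  · rw [← mul_assoc, coeff_mul_X']
    simp [h]

/-- Representatives of continuous splines that are `C¹` across the faces through the `k`-th ray. -/
def raySpace (r : ℕ) (k : Fin 4) : Submodule ℝ Q4 :=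
  contSpace r ⊓ (vanishNear k).comap (sumD : Q4 →ₗ[ℝ] Q4)

lemma mem_raySpace {r : ℕ} {k : Fin 4} {F : Q4} :
    F ∈ raySpace r k ↔ F ∈ contSpace r ∧ sumD F ∈ vanishNear k := Iff.rfl

lemma three_mem {k i j l : Fin 4} (hij : i ≠ j) (hil : i ≠ l) (hjl : j ≠ l) (hi : i ≠ k)
    (hj : j ≠ k) (hl : l ≠ k) (P : Q4) : sumD (P * (X i * X j * X l)) ∈ vanishNear k := by
  have : sumD (P * (X i * X j * X l)) = (sumD P * X l + P) * (X i * X j) +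
      P * (X i * X l) + P * (X j * X l) := by
    simp only [Derivation.leibniz, sumD_X, smul_eq_mul]
    ring
  rw [this]
  exact add_mem (add_mem (mul_X_mul_X_mem_vanishNear hij hi hj _)
    (mul_X_mul_X_mem_vanishNear hil hi hl _)) (mul_X_mul_X_mem_vanishNear hjl hj hl _)

lemma two_mem {k i j : Fin 4} (hij : i ≠ j) (hi : i ≠ k)
    (hj : j ≠ k) (P : Q4) : sumD (P * (X i * X j) ^ 2) ∈ vanishNear k := by
  have : sumD (P * (X i * X j) ^ 2) =
      (sumD P * (X i * X j) + 2 * P * X i + 2 * P * X j) * (X i * X j) := by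
    simp only [Derivation.leibniz, sumD_X, smul_eq_mul, pow_two]
    ring
  rw [this]
  exact mul_X_mul_X_mem_vanishNear hij hi hj _

lemma pow_mul_mem {k i j : Fin 4} (hij : i ≠ j) (hi : i ≠ k)
    (hj : j ≠ k) (a : ℕ) :
    sumD (X i ^ (a + 2) * ((a + 3 : ℝ) • X j - X i)) ∈ vanishNear k := by
  have : sumD (X i ^ (a + 2) * ((a + 3 : ℝ) • X j - X i)) =
      (C ((a + 2) * (a + 3) : ℝ) * X i ^ a) * (X i * X j) := by
    simp only [Derivation.leibniz, Derivation.leibniz_pow, map_sub, sumD_X, smul_eq_mul,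
      smul_eq_C_mul, nsmul_eq_mul, sumD_C]
    simp only [map_natCast, map_ofNat, map_mul, map_add,
      show a + 2 - 1 = a + 1 by omega]
    push_cast
    ring
  rw [this]
  exact mul_X_mul_X_mem_vanishNear hij hi hj _

lemma X_pow_mul_eq (i j l : Fin 4) (a b c : ℕ) : (X i ^ a * X j ^ b * X l ^ c : Q4) =
    monomial (Finsupp.single i a + Finsupp.single j b + Finsupp.single l c) 1 := by
  simp [X_pow_eq_monomial, monomial_mul]

lemma prod_mem_contSpace {r : ℕ} (i j l : Fin 4) {a b c : ℕ} (h : a + b + c ≤ r) :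
    (X i ^ a * X j ^ b * X l ^ c : Q4) ∈ contSpace r := by
  rw [X_pow_mul_eq, contSpace, monomial_mem_restrictSupport]
  left
  refine ⟨by simpa using h, ?_⟩
  obtain ⟨n, h1, h2, h3⟩ : ∃ n : Fin 4, n ≠ i ∧ n ≠ j ∧ n ≠ l := by
    decide +revert
  exact ⟨n, by simp [h1, h2, h3]⟩

lemma finrank_inf_ker_add_finrank_map {E F : Type*} [AddCommGroup E] [Module ℝ E]
    [AddCommGroup F] [Module ℝ F] (A : Submodule ℝ E) [FiniteDimensional ℝ A] (f : E →ₗ[ℝ] F) :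
    Module.finrank ℝ (A ⊓ f.ker : Submodule ℝ E) + Module.finrank ℝ (A.map f) =
      Module.finrank ℝ A := by
  have h := (f.domRestrict A).finrank_range_add_finrank_ker
  rw [LinearMap.range_domRestrict] at h
  have h1 : A ⊓ f.ker = (f.domRestrict A).ker.map A.subtype := by
    ext v
    simp [and_comm]
  rw [← h, add_comm, h1, Submodule.finrank_map_subtype_eq]

lemma map_eq_top_of_single {E ι : Type*} [AddCommGroup E] [Module ℝ E] [Finite ι] [DecidableEq ι]
    (A : Submodule ℝ E) (f : E →ₗ[ℝ] (ι → ℝ)) (h : ∀ i, ∃ a ∈ A, f a = Pi.single i 1) :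
    A.map f = ⊤ := by
  cases nonempty_fintype ι
  rw [eq_top_iff]
  rintro v -
  rw [pi_eq_sum_univ' v]
  refine Submodule.sum_mem _ fun i _ => Submodule.smul_mem _ _ ?_
  obtain ⟨a, ha, h⟩ := h i
  refine ⟨a, ha, h.trans ?_⟩
  ext j
  simp [Pi.single_apply, eq_comm]

lemma finite_exponents (r : ℕ) : {α : Fin 4 →₀ ℕ | α.degree ≤ r}.Finite :=
  Finsupp.finite_of_degree_le r

instance (r : ℕ) : FiniteDimensional ℝ (contSpace r) := by
  have : Finite {α : Fin 4 →₀ ℕ | α.degree ≤ r ∧ ∃ i, α i = 0} :=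
    (finite_exponents r).subset fun _ h => h.1
  exact (basisRestrictSupport ℝ _).finiteDimensional_of_finite

lemma finrank_contSpace_eq_card (r : ℕ) : Module.finrank ℝ (contSpace r) =
    Nat.card {α : Fin 4 →₀ ℕ | α.degree ≤ r ∧ ∃ i, α i = 0} :=
  Module.finrank_eq_nat_card_basis (basisRestrictSupport ℝ _)

/-- Exponents of the conditions defining `raySpace`. -/
def rayExponents (r : ℕ) (k : Fin 4) : Set (Fin 4 →₀ ℕ) := {β | NearRay k β ∧ β.degree < r}

/-- Exponents of the vertex conditions. -/
def vertexExponents (r : ℕ) : Set (Fin 4 →₀ ℕ) := {β | ∃ k a, a < r ∧ β = Finsupp.single k a}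

instance (r : ℕ) (k : Fin 4) : Finite (rayExponents r k) :=
  (finite_exponents r).subset fun _ h => h.2.le

instance (r : ℕ) : Finite (vertexExponents r) :=
  (finite_exponents r).subset fun β h => by
    obtain ⟨k, a, h, rfl⟩ := h
    simpa using h.le

/-- The coefficients of `sumD F` with exponents in `B`. -/
def coeffSumD (B : Set (Fin 4 →₀ ℕ)) : Q4 →ₗ[ℝ] (B → ℝ) :=
  LinearMap.pi fun β => lcoeff ℝ β.1 ∘ₗ (sumD : Q4 →ₗ[ℝ] Q4)

lemma coeffSumD_apply (B : Set (Fin 4 →₀ ℕ)) (F : Q4) (β : B) :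
    coeffSumD B F β = coeff β.1 (sumD F) := rfl

lemma coeff_sumD_eq_zero {r : ℕ} {F : Q4} (hF : F ∈ contSpace r) {β : Fin 4 →₀ ℕ}
    (h : r ≤ β.degree) : coeff β (sumD F) = 0 := by
  rw [coeff_sumD]
  refine Finset.sum_eq_zero fun n _ => ?_
  have : coeff (β + Finsupp.single n 1) F = 0 := by
    by_contra h0
    have := (mem_contSpace.1 hF _ h0).1
    simp at this
    omega
  simp [this]

lemma raySpace_eq (r : ℕ) (k : Fin 4) :
    raySpace r k = contSpace r ⊓ (coeffSumD (rayExponents r k)).ker := by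
  ext F
  rw [mem_raySpace, Submodule.mem_inf, LinearMap.mem_ker, funext_iff]
  refine and_congr_right fun hF => ⟨fun h β => h _ β.2.1, fun h β hβ => ?_⟩
  by_cases hr : β.degree < r
  · exact h ⟨β, hβ, hr⟩
  · exact coeff_sumD_eq_zero hF (not_lt.1 hr)

lemma nearRay_iff {k : Fin 4} {β : Fin 4 →₀ ℕ} : NearRay k β ↔
    ∃ m, m ≠ k ∧ β = Finsupp.single k (β k) + Finsupp.single m (β m) := by
  constructor
  · rintro ⟨i, j, hij, hi, hj, h1, h2⟩
    obtain ⟨m, hm, h⟩ : ∃ m, m ≠ k ∧ ∀ n, n = k ∨ n = m ∨ n = i ∨ n = j := by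
      clear h1 h2
      decide +revert
    refine ⟨m, hm, ?_⟩
    ext n
    rcases h n with rfl | rfl | rfl | rfl <;>
      simp_all [Finsupp.single_apply, eq_comm]
  · rintro ⟨m, hm, h⟩
    obtain ⟨i, j, h1, h2, h3, h4, h5⟩ : ∃ i j, i ≠ j ∧ i ≠ k ∧ j ≠ k ∧ i ≠ m ∧ j ≠ m := by
      clear h
      decide +revert
    refine ⟨i, j, h1, h2, h3, ?_, ?_⟩ <;> rw [h] <;> simp [h2, h3, h4, h5]

lemma exists_raySpace_single {r : ℕ} {k : Fin 4} {β : Fin 4 →₀ ℕ} (hβ : NearRay k β)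
    (hr : β.degree < r) : ∃ F ∈ contSpace r, sumD F - monomial β 1 ∈ vanishNear k := by
  obtain ⟨m, hm, h⟩ := nearRay_iff.1 hβ
  obtain ⟨i, l, hil, hi, hl, him, hlm⟩ : ∃ i j, i ≠ j ∧ i ≠ k ∧ j ≠ k ∧ i ≠ m ∧ j ≠ m := by
    clear h hβ hr β r
    decide +revert
  generalize β k = a at h
  generalize β m = b at h
  subst h
  simp at hr
  match b with
  | 0 =>
    refine ⟨(a + 1 : ℝ)⁻¹ • (X k ^ (a + 1) * X k ^ 0 * X k ^ 0),
      Submodule.smul_mem _ _ (prod_mem_contSpace k k k (by omega)), ?_⟩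
    have : sumD ((a + 1 : ℝ)⁻¹ • (X k ^ (a + 1) * X k ^ 0 * X k ^ 0)) = X k ^ a := by
      have h0 : (a + 1 : ℝ) ≠ 0 := by positivity
      rw [pow_zero, mul_one, mul_one, Derivation.map_smul, Derivation.leibniz_pow, sumD_X,
        inv_smul_eq_iff₀ h0, ← Nat.cast_succ, Nat.cast_smul_eq_nsmul]
      simp
    rw [this]
    simp [X_pow_eq_monomial]
  | 1 =>
    refine ⟨(2 : ℝ)⁻¹ • (X k ^ a * X m ^ 1 * X i ^ 1 + X k ^ a * X m ^ 1 * X l ^ 1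
      - X k ^ a * X i ^ 1 * X l ^ 1), Submodule.smul_mem _ _ (sub_mem (add_mem
        (prod_mem_contSpace _ _ _ (by omega)) (prod_mem_contSpace _ _ _ (by omega)))
        (prod_mem_contSpace _ _ _ (by omega))), ?_⟩
    have : sumD ((2 : ℝ)⁻¹ • (X k ^ a * X m ^ 1 * X i ^ 1 + X k ^ a * X m ^ 1 * X l ^ 1
      - X k ^ a * X i ^ 1 * X l ^ 1)) - monomial (Finsupp.single k a + Finsupp.single m 1) 1 =
      (2 : ℝ)⁻¹ • (sumD (X k ^ a) * (X m * X i) + sumD (X k ^ a) * (X m * X l) -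
        sumD (X k ^ a) * (X i * X l)) := by
      rw [Derivation.map_smul, sub_eq_iff_eq_add, inv_smul_eq_iff₀ two_ne_zero, smul_add,
        smul_inv_smul₀ two_ne_zero, ← mul_one (1 : ℝ), ← monomial_mul, ← X_pow_eq_monomial,
        ← X_pow_eq_monomial]
      simp only [map_sub, map_add, Derivation.leibniz, sumD_X, smul_eq_mul, pow_one, two_smul]
      ring
    rw [this]
    exact Submodule.smul_mem _ _ (sub_mem (add_mem (mul_X_mul_X_mem_vanishNear him.symm hm hi _)
      (mul_X_mul_X_mem_vanishNear hlm.symm hm hl _)) (mul_X_mul_X_mem_vanishNear hil hi hl _))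
  | b + 2 =>
    refine ⟨X k ^ a * X m ^ (b + 2) * X i ^ 1, prod_mem_contSpace _ _ _ (by omega), ?_⟩
    have : sumD (X k ^ a * X m ^ (b + 2) * X i ^ 1) -
        monomial (Finsupp.single k a + Finsupp.single m (b + 2)) 1 =
        (sumD (X k ^ a) * X m ^ (b + 1) + ((b : Q4) + 2) * (X k ^ a * X m ^ b)) * (X m * X i) := by
      rw [← mul_one (1 : ℝ), ← monomial_mul, ← X_pow_eq_monomial, ← X_pow_eq_monomial]
      simp only [Derivation.leibniz, Derivation.leibniz_pow (D := sumD) (X m), sumD_X,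
        smul_eq_mul, pow_one, nsmul_eq_mul, show b + 2 - 1 = b + 1 by omega]
      push_cast
      ring
    rw [this]
    exact mul_X_mul_X_mem_vanishNear him.symm hm hi _

lemma finrank_raySpace_add (r : ℕ) (k : Fin 4) : Module.finrank ℝ (raySpace r k) +
    Nat.card (rayExponents r k) = Module.finrank ℝ (contSpace r) := by
  classical
  rw [raySpace_eq, ← finrank_inf_ker_add_finrank_map (contSpace r)
    (coeffSumD (rayExponents r k)), map_eq_top_of_single]
  · cases nonempty_fintype (rayExponents r k)
    simp
  rintro ⟨β, hβ, hr⟩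
  obtain ⟨F, hF, h⟩ := exists_raySpace_single hβ hr
  refine ⟨F, hF, ?_⟩
  ext ⟨γ, hγ, h'⟩
  have := h γ hγ
  rw [coeff_sub, sub_eq_zero, coeff_monomial] at this
  rw [coeffSumD_apply, this, Pi.single_apply]
  simp [Subtype.ext_iff, eq_comm]

lemma card_degree_eq (n : ℕ) : Nat.card {α : Fin 4 →₀ ℕ | α.degree = n} = (n + 3).choose 3 := by
  have : {α : Fin 4 →₀ ℕ | α.degree = n} =
      (Finset.univ.finsuppAntidiag n : Finset (Fin 4 →₀ ℕ)) := by
    ext α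
    simp [Finsupp.degree_eq_sum]
  rw [this, Nat.card_coe_set_eq, Set.ncard_coe_finset,
    Finset.card_finsuppAntidiag_nat_eq_choose]
  simp only [Finset.card_univ, Fintype.card_fin]
  rw [show 4 + n - 1 = n + 3 by omega]
  exact (Nat.choose_symm_add (a := n) (b := 3))

lemma card_degree_le (n : ℕ) : Nat.card {α : Fin 4 →₀ ℕ | α.degree ≤ n} = (n + 4).choose 4 := by
  induction n with
  | zero =>
    have : {α : Fin 4 →₀ ℕ | α.degree ≤ 0} = {α | α.degree = 0} := by simp
    rw [this, card_degree_eq]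
    rfl
  | succ n ih =>
    have : {α : Fin 4 →₀ ℕ | α.degree ≤ n + 1} =
        {α | α.degree ≤ n} ∪ {α | α.degree = n + 1} := by
      ext; simp; omega
    rw [Nat.card_coe_set_eq] at ih ⊢
    rw [this, Set.ncard_union_eq ?_ (finite_exponents n) (Finsupp.finite_of_degree_eq _), ih,
      ← Nat.card_coe_set_eq, card_degree_eq, Nat.choose_succ_succ' (n + 4) 3, add_comm]
    rw [Set.disjoint_left]
    simp
    omega

lemma card_degree_le_pos (r : ℕ) :
    Nat.card {α : Fin 4 →₀ ℕ | α.degree ≤ r ∧ ∀ i, α i ≠ 0} = r.choose 4 := by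
  rcases lt_or_ge r 4 with h | h
  · rw [Nat.choose_eq_zero_of_lt h, Nat.card_eq_zero]
    left
    refine ⟨fun ⟨α, h1, h2⟩ => ?_⟩
    rw [Finsupp.degree_eq_sum, Fin.sum_univ_four] at h1
    have := h2 0; have := h2 1; have := h2 2; have := h2 3
    omega
  · obtain ⟨n, rfl⟩ := Nat.exists_eq_add_of_le' h
    rw [← card_degree_le]
    refine Nat.card_congr ⟨fun α => ⟨α.1 - Finsupp.equivFunOnFinite.symm 1, ?_⟩,
      fun α => ⟨α.1 + Finsupp.equivFunOnFinite.symm 1, ?_, ?_⟩, ?_, ?_⟩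
    · obtain ⟨α, h1, h2⟩ := α
      simp only [Set.mem_ofPred_eq, Finsupp.degree_eq_sum, Fin.sum_univ_four] at h1 ⊢
      have := h2 0; have := h2 1; have := h2 2; have := h2 3
      simp
      omega
    · obtain ⟨α, h1⟩ := α
      simp only [Set.mem_ofPred_eq, Finsupp.degree_eq_sum, Fin.sum_univ_four] at h1 ⊢
      simp
      omega
    · simp
    · rintro ⟨α, h1, h2⟩
      ext i
      have := h2 i
      simp
      omega
    · rintro ⟨α, h1⟩
      ext i
      simp

lemma choose_add_four (r : ℕ) : 3 * (r + 4).choose 4 =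
    3 * r.choose 4 + (r * (r + 1) * (2 * r + 1) + 6 * r + 3) := by
  rcases lt_or_ge r 4 with h | h
  · interval_cases r <;> rfl
  · obtain ⟨n, rfl⟩ := Nat.exists_eq_add_of_le' h
    have h1 := Nat.descFactorial_eq_factorial_mul_choose (n + 4 + 4) 4
    have h2 := Nat.descFactorial_eq_factorial_mul_choose (n + 4) 4
    simp only [Nat.descFactorial, Nat.factorial, show n + 4 - 3 = n + 1 by omega,
      show n + 4 - 2 = n + 2 by omega, show n + 4 - 1 = n + 3 by omega,
      show n + 4 + 4 - 3 = n + 5 by omega, show n + 4 + 4 - 2 = n + 6 by omega,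
      show n + 4 + 4 - 1 = n + 7 by omega, Nat.sub_zero] at h1 h2
    nlinarith

lemma card_contExponents (r : ℕ) :
    Nat.card {α : Fin 4 →₀ ℕ | α.degree ≤ r ∧ ∃ i, α i = 0} + r.choose 4 = (r + 4).choose 4 := by
  rw [← card_degree_le, ← card_degree_le_pos]
  simp only [Nat.card_coe_set_eq]
  rw [← Set.ncard_union_eq ?_ ((finite_exponents r).subset fun _ h => h.1)
    ((finite_exponents r).subset fun _ h => h.1)]
  · congr 1
    ext α
    simp only [Set.mem_union, Set.mem_ofPred_eq, ← and_or_left]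
    rw [and_iff_left_iff_imp]
    intro _
    by_contra! h
    obtain ⟨h, i, hi⟩ := h
    exact h i hi
  · rw [Set.disjoint_left]
    rintro α ⟨-, i, hi⟩ ⟨-, h⟩
    exact h i hi

lemma card_rayExponents (r : ℕ) (k : Fin 4) :
    2 * Nat.card (rayExponents r k) + r = 3 * r ^ 2 := by
  let e : Fin r ⊕ ({m // m ≠ k} × (Σ s : Fin r, Fin s)) → (Fin 4 →₀ ℕ) := Sum.elim
    (fun a => Finsupp.single k a.val)
    (fun p => Finsupp.single k (p.2.1.val - (p.2.2.val + 1)) +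
      Finsupp.single p.1.val (p.2.2.val + 1))
  have he : e.Injective := by
    rintro (a | ⟨⟨m, hm⟩, s, t⟩) (b | ⟨⟨m', hm'⟩, s', t'⟩) h
    · have := DFunLike.congr_fun h k
      simp only [e, Sum.elim_inl, Finsupp.single_eq_same] at this
      rw [Fin.ext this]
    · have := DFunLike.congr_fun h m'
      simp [e, hm'] at this
    · have := DFunLike.congr_fun h m
      simp [e, hm] at this
    · have h1 := DFunLike.congr_fun h k
      have h2 := DFunLike.congr_fun h m
      simp only [e, Sum.elim_inr, Finsupp.add_apply, Finsupp.single_eq_same,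
        Finsupp.single_eq_of_ne hm, Finsupp.single_eq_of_ne hm.symm,
        Finsupp.single_eq_of_ne hm'.symm, zero_add, add_zero] at h1 h2
      obtain rfl : m = m' := by
        by_contra h3
        simp [Finsupp.single_eq_of_ne h3] at h2
      rw [Finsupp.single_eq_same] at h2
      obtain ⟨s, hs⟩ := s
      obtain ⟨t, ht⟩ := t
      obtain ⟨s', hs'⟩ := s'
      obtain ⟨t', ht'⟩ := t'
      simp only at h1 h2 ht ht'
      obtain rfl : s = s' := by omega
      obtain rfl : t = t' := by omega
      rfl
  have hr : Set.range e = rayExponents r k := by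
    ext β
    constructor
    · rintro ⟨a | ⟨⟨m, hm⟩, ⟨s, hs⟩, ⟨t, ht⟩⟩, rfl⟩
      · obtain ⟨m, hm⟩ := exists_ne k
        exact ⟨nearRay_iff.2 ⟨m, hm, by simp [e, hm]⟩, by simp [e]⟩
      · refine ⟨nearRay_iff.2 ⟨m, hm, by simp [e, hm, hm.symm]⟩, ?_⟩
        simp only [e, Sum.elim_inr, map_add, Finsupp.degree_single]
        simp only at ht
        omega
    · rintro ⟨hβ, hr⟩
      obtain ⟨m, hm, h⟩ := nearRay_iff.1 hβ
      generalize β k = a at h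
      generalize β m = b at h
      subst h
      simp only [map_add, Finsupp.degree_single] at hr
      rcases b with _ | b
      · exact ⟨.inl ⟨a, by omega⟩, by simp [e]⟩
      · refine ⟨.inr ⟨⟨m, hm⟩, ⟨a + (b + 1), hr⟩, ⟨b, ?_⟩⟩, ?_⟩
        · change b < a + (b + 1)
          omega
        · simp [e]
  rw [← hr, Nat.card_range_of_injective he, Nat.card_eq_fintype_card]
  have h1 := Finset.sum_range_id_mul_two r
  have h3 : Fintype.card {m // m ≠ k} = 3 := by simp
  rw [Fintype.card_sum, Fintype.card_prod, h3, Fintype.card_sigma]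
  simp only [Fintype.card_fin]
  rw [Fin.sum_univ_eq_sum_range (fun i => i) r]
  rcases r with _ | r
  · simp
  · simp only [Nat.add_sub_cancel] at h1
    linarith

lemma card_vertexExponents {r : ℕ} (hr : 1 ≤ r) : Nat.card (vertexExponents r) + 3 = 4 * r := by
  obtain ⟨r, rfl⟩ := Nat.exists_eq_add_of_le' hr
  let e : Option (Fin 4 × Fin r) → (Fin 4 →₀ ℕ) := fun o =>
    o.elim 0 (fun p => Finsupp.single p.1 (p.2.val + 1))
  have he : e.Injective := by
    rintro (_ | ⟨k, a⟩) (_ | ⟨k', a'⟩) h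
    · rfl
    · simp [e, eq_comm] at h
    · simp [e] at h
    · rcases (Finsupp.single_eq_single_iff _ _ _ _).1 h with ⟨rfl, h⟩ | ⟨h, -⟩
      · obtain rfl : a = a' := Fin.ext (Nat.succ_injective h)
        rfl
      · omega
  have h : Set.range e = vertexExponents (r + 1) := by
    ext β
    constructor
    · rintro ⟨_ | ⟨k, a⟩, rfl⟩
      · exact ⟨0, 0, by omega, by simp [e]⟩
      · exact ⟨k, a.val + 1, by omega, rfl⟩
    · rintro ⟨k, a, h, rfl⟩
      rcases a with _ | a
      · exact ⟨none, by simp [e]⟩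
      · exact ⟨some (k, ⟨a, by omega⟩), rfl⟩
  rw [← h, Nat.card_range_of_injective he, Nat.card_eq_fintype_card]
  simp
  omega

lemma nearRay_single (i k : Fin 4) (a : ℕ) : NearRay k (Finsupp.single i a) := by
  obtain ⟨m, n, h1, h2, h3, h4, h5⟩ :
      ∃ m n, m ≠ n ∧ m ≠ k ∧ n ≠ k ∧ m ≠ i ∧ n ≠ i := by
    decide +revert
  exact ⟨m, n, h1, h2, h3, by simp [h4], by simp [h5]⟩

/-- Representatives of continuous splines that are differentiable at the vertices. -/
def vertexSpace (r : ℕ) : Submodule ℝ Q4 :=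
  contSpace r ⊓ (coeffSumD (vertexExponents r)).ker

lemma mem_vertexSpace {r : ℕ} {F : Q4} : F ∈ vertexSpace r ↔
    F ∈ contSpace r ∧ ∀ k a, coeff (Finsupp.single k a) (sumD F) = 0 := by
  rw [vertexSpace, Submodule.mem_inf, LinearMap.mem_ker, funext_iff]
  refine and_congr_right fun hF => ⟨fun h k a => ?_, ?_⟩
  · by_cases hr : a < r
    · exact h ⟨_, k, a, hr, rfl⟩
    · exact coeff_sumD_eq_zero hF (by simpa using hr)
  · rintro h ⟨_, k, a, hr, rfl⟩
    exact h k a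

lemma raySpace_le_vertexSpace (r : ℕ) (k : Fin 4) : raySpace r k ≤ vertexSpace r :=
  fun _ h => mem_vertexSpace.2 ⟨h.1, fun i a => h.2 _ (nearRay_single i k a)⟩

lemma finrank_vertexSpace_add (r : ℕ) : Module.finrank ℝ (vertexSpace r) +
    Nat.card (vertexExponents r) = Module.finrank ℝ (contSpace r) := by
  classical
  rw [vertexSpace, ← finrank_inf_ker_add_finrank_map (contSpace r)
    (coeffSumD (vertexExponents r)), map_eq_top_of_single]
  · cases nonempty_fintype (vertexExponents r)
    simp
  rintro ⟨_, k, a, h, rfl⟩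
  refine ⟨(a + 1 : ℝ)⁻¹ • (X k ^ (a + 1) * X k ^ 0 * X k ^ 0),
    Submodule.smul_mem _ _ (prod_mem_contSpace k k k (by omega)), ?_⟩
  have : sumD ((a + 1 : ℝ)⁻¹ • (X k ^ (a + 1) * X k ^ 0 * X k ^ 0)) = X k ^ a := by
    have h0 : (a + 1 : ℝ) ≠ 0 := by positivity
    rw [pow_zero, mul_one, mul_one, Derivation.map_smul, Derivation.leibniz_pow, sumD_X,
      inv_smul_eq_iff₀ h0, ← Nat.cast_succ, Nat.cast_smul_eq_nsmul]
    simp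
  ext ⟨β, hβ⟩
  rw [coeffSumD_apply, this, coeff_X_pow, Pi.single_apply]
  simp [Subtype.ext_iff, eq_comm]

/-- A complement of `vertexSpace`. -/
def vertexComplement : Submodule ℝ Q4 :=
  restrictSupport ℝ (insert (Finsupp.single 0 1) {α | ∃ k a, α = Finsupp.single k (a + 2)})

lemma eq_zero_of_mem_vertexComplement {F : Q4} (hF : F ∈ vertexComplement)
    (h : ∀ k a, coeff (Finsupp.single k a) (sumD F) = 0) : F = 0 := by
  have key : ∀ α, coeff α F ≠ 0 →
      α = Finsupp.single 0 1 ∨ ∃ k a, α = Finsupp.single k (a + 2) := by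
    intro α hα
    exact hF (mem_support_iff.2 hα)
  ext α
  rw [coeff_zero]
  by_contra hα
  rcases key α hα with rfl | ⟨k, a, rfl⟩
  · have h0 := h 0 0
    rw [Finsupp.single_zero, coeff_sumD, Finset.sum_eq_single 0] at h0
    · exact hα (by simpa using h0)
    · intro n _ hn
      have : coeff (0 + Finsupp.single n 1) F = 0 := by
        by_contra h1
        rcases key _ h1 with h2 | ⟨k, a, h2⟩
        · have := DFunLike.congr_fun h2 n
          simp [hn] at this
        · have := congrArg Finsupp.degree h2
          simp at this
      rw [this, zero_mul]
    · simp
  · have h0 := h k (a + 1)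
    rw [coeff_sumD, Finset.sum_eq_single k] at h0
    · rw [← Finsupp.single_add] at h0
      rcases mul_eq_zero.1 h0 with h0 | h0
      · exact hα h0
      · have : (0 : ℝ) ≤ (Finsupp.single k (a + 1)) k := Nat.cast_nonneg _
        linarith
    · intro n _ hn
      have : coeff (Finsupp.single k (a + 1) + Finsupp.single n 1) F = 0 := by
        by_contra h1
        rcases key _ h1 with h2 | ⟨k', a', h2⟩
        · have := congrArg Finsupp.degree h2
          simp at this
        · have h3 := DFunLike.congr_fun h2 n
          have h4 := DFunLike.congr_fun h2 k
          simp [hn, hn.symm, Finsupp.single_apply] at h3 h4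
          split_ifs at h3 h4
          simp_all
      rw [this, zero_mul]
    · simp

/-- The sum of the four ray spaces. -/
def raySum (r : ℕ) : Submodule ℝ Q4 := ⨆ k, raySpace r k

lemma mem_raySum {r : ℕ} {F : Q4} (k : Fin 4) (h : F ∈ raySpace r k) : F ∈ raySum r :=
  le_iSup (raySpace r) k h

lemma pow_mem_sup {r a : ℕ} (k : Fin 4) (h : a ≤ r) :
    (X k ^ a : Q4) ∈ raySum r ⊔ vertexComplement := by
  match a with
  | 0 =>
    refine Submodule.mem_sup_left (mem_raySum k ⟨?_, ?_⟩)
    · simpa using prod_mem_contSpace k k k (a := 0) (b := 0) (c := 0) h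
    · simp
  | 1 =>
    rw [pow_one, ← sub_add_cancel (X k : Q4) (X 0)]
    refine Submodule.add_mem_sup (mem_raySum k ⟨sub_mem ?_ ?_, ?_⟩) ?_
    · simpa using prod_mem_contSpace k k k (a := 1) (b := 0) (c := 0) h
    · simpa using prod_mem_contSpace 0 0 0 (a := 1) (b := 0) (c := 0) h
    · simp [sumD_X]
    · rw [vertexComplement, X, monomial_mem_restrictSupport]
      exact .inl (.inl rfl)
  | a + 2 =>
    refine Submodule.mem_sup_right ?_
    rw [vertexComplement, X_pow_eq_monomial, monomial_mem_restrictSupport]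
    exact .inl (.inr ⟨k, a, rfl⟩)

lemma pow_mul_mem_sup {r a : ℕ} {i j : Fin 4} (hij : i ≠ j) (h : a + 1 ≤ r) :
    (X i ^ a * X j : Q4) ∈ raySum r ⊔ vertexComplement := by
  obtain ⟨k, hi, hj⟩ : ∃ k, i ≠ k ∧ j ≠ k := by
    clear h
    decide +revert
  match a with
  | 0 => simpa using pow_mem_sup j h
  | 1 =>
    have : (X i ^ 1 * X j : Q4) = (2 : ℝ)⁻¹ • (X i ^ 2 + X j ^ 2 - (X i - X j) ^ 2) := by
      rw [eq_inv_smul_iff₀ two_ne_zero, two_smul]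
      ring
    rw [this]
    refine Submodule.smul_mem _ _ (sub_mem (add_mem (pow_mem_sup i h) (pow_mem_sup j h))
      (Submodule.mem_sup_left (mem_raySum k ⟨?_, ?_⟩)))
    · rw [show (X i - X j : Q4) ^ 2 = X i ^ 2 * X i ^ 0 * X i ^ 0 + X j ^ 2 * X i ^ 0 * X i ^ 0 -
        (2 : ℝ) • (X i ^ 1 * X j ^ 1 * X i ^ 0) by rw [smul_eq_C_mul, map_ofNat]; ring]
      exact sub_mem (add_mem (prod_mem_contSpace _ _ _ h) (prod_mem_contSpace _ _ _ h))
        (Submodule.smul_mem _ _ (prod_mem_contSpace _ _ _ h))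
    · have : sumD ((X i - X j) ^ 2) = 0 := by
        simp [Derivation.leibniz_pow, sumD_X]
      change sumD ((X i - X j) ^ 2) ∈ vanishNear k
      rw [this]
      exact zero_mem _
  | a + 2 =>
    have h0 : (a + 3 : ℝ) ≠ 0 := by positivity
    have : (X i ^ (a + 2) * X j : Q4) =
        (a + 3 : ℝ)⁻¹ • (X i ^ (a + 2) * ((a + 3 : ℝ) • X j - X i) + X i ^ (a + 3)) := by
      rw [eq_inv_smul_iff₀ h0, mul_sub, mul_smul_comm]
      ring
    rw [this]
    refine Submodule.smul_mem _ _ (add_mem (Submodule.mem_sup_left (mem_raySum k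
      ⟨?_, pow_mul_mem hij hi hj a⟩)) (pow_mem_sup i h))
    rw [show (X i ^ (a + 2) * ((a + 3 : ℝ) • X j - X i) : Q4) =
      (a + 3 : ℝ) • (X i ^ (a + 2) * X j ^ 1 * X i ^ 0) - X i ^ (a + 3) * X i ^ 0 * X i ^ 0 by
        rw [smul_eq_C_mul, smul_eq_C_mul]; ring]
    exact sub_mem (Submodule.smul_mem _ _ (prod_mem_contSpace _ _ _ h))
      (prod_mem_contSpace _ _ _ h)

lemma two_pow_mem_sup {r a b : ℕ} {i j : Fin 4} (hij : i ≠ j) (h : a + b ≤ r) :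
    (X i ^ a * X j ^ b : Q4) ∈ raySum r ⊔ vertexComplement := by
  match a, b with
  | a, 0 => simpa using pow_mem_sup i h
  | 0, b => simpa using pow_mem_sup j (by simpa using h)
  | a, 1 => simpa using pow_mul_mem_sup hij h
  | 1, b => simpa [mul_comm] using pow_mul_mem_sup (a := b) hij.symm (by omega)
  | a + 2, b + 2 =>
    obtain ⟨k, hi, hj⟩ : ∃ k, i ≠ k ∧ j ≠ k := by
      clear h
      decide +revert
    refine Submodule.mem_sup_left (mem_raySum k ⟨?_, ?_⟩)
    · simpa using prod_mem_contSpace i j i (c := 0) h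
    · rw [show (X i ^ (a + 2) * X j ^ (b + 2) : Q4) = (X i ^ a * X j ^ b) * (X i * X j) ^ 2 by
        ring]
      exact two_mem hij hi hj _

lemma three_pow_mem_sup {r a b c : ℕ} {i j l : Fin 4} (hij : i ≠ j) (hil : i ≠ l) (hjl : j ≠ l)
    (h : a + b + c ≤ r) :
    (X i ^ a * X j ^ b * X l ^ c : Q4) ∈ raySum r ⊔ vertexComplement := by
  match a, b, c with
  | 0, b, c => simpa using two_pow_mem_sup hjl (by simpa using h)
  | a, 0, c => simpa using two_pow_mem_sup hil (by simpa using h)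
  | a, b, 0 => simpa using two_pow_mem_sup hij (by simpa using h)
  | a + 1, b + 1, c + 1 =>
    obtain ⟨k, hi, hj, hl⟩ : ∃ k, i ≠ k ∧ j ≠ k ∧ l ≠ k := by
      clear h
      decide +revert
    refine Submodule.mem_sup_left (mem_raySum k ⟨prod_mem_contSpace i j l h, ?_⟩)
    rw [show (X i ^ (a + 1) * X j ^ (b + 1) * X l ^ (c + 1) : Q4) =
      (X i ^ a * X j ^ b * X l ^ c) * (X i * X j * X l) by ring]
    exact three_mem hij hil hjl hi hj hl _

lemma contSpace_le_sup (r : ℕ) : contSpace r ≤ raySum r ⊔ vertexComplement := by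
  rw [contSpace, restrictSupport_eq_span, Submodule.span_le]
  rintro _ ⟨α, ⟨hr, k, hk⟩, rfl⟩
  obtain ⟨i, j, l, hij, hil, hjl, hi, hj, hl, hall⟩ : ∃ i j l, i ≠ j ∧ i ≠ l ∧ j ≠ l ∧
      i ≠ k ∧ j ≠ k ∧ l ≠ k ∧ ∀ n, n = i ∨ n = j ∨ n = l ∨ n = k := by
    clear hk
    decide +revert
  have : α = Finsupp.single i (α i) + Finsupp.single j (α j) + Finsupp.single l (α l) := by
    ext n
    rcases hall n with rfl | rfl | rfl | rfl <;> simp [*, Ne.symm]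
  rw [this] at hr ⊢
  change monomial _ 1 ∈ _
  rw [← X_pow_mul_eq]
  simp only [map_add, Finsupp.degree_single] at hr
  exact three_pow_mem_sup hij hil hjl hr

lemma raySum_eq (r : ℕ) : raySum r = vertexSpace r := by
  have h1 : raySum r ≤ vertexSpace r := iSup_le (raySpace_le_vertexSpace r)
  refine h1.antisymm fun F hF => ?_
  obtain ⟨s, hs, w, hw, rfl⟩ := Submodule.mem_sup.1 (contSpace_le_sup r hF.1)
  have h2 : w = 0 := by
    refine eq_zero_of_mem_vertexComplement hw fun k a => ?_
    have h3 := (mem_vertexSpace.1 hF).2 k a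
    rwa [map_add, coeff_add, (mem_vertexSpace.1 (h1 hs)).2 k a, zero_add] at h3
  rwa [h2, add_zero]

/-- Coordinates of the splines whose curl is continuous. -/
def coordSpace (r : ℕ) : Submodule ℝ (Fin 4 → Q4) :=
  Submodule.pi Set.univ (raySpace r) ⊓ (∑ k, LinearMap.proj k : (Fin 4 → Q4) →ₗ[ℝ] Q4).ker

lemma mem_coordSpace {r : ℕ} {F : Fin 4 → Q4} :
    F ∈ coordSpace r ↔ (∀ k, F k ∈ raySpace r k) ∧ ∑ k, F k = 0 := by
  simp [coordSpace]

instance (r : ℕ) (k : Fin 4) : FiniteDimensional ℝ (raySpace r k) :=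
  Submodule.finiteDimensional_of_le (inf_le_left : _ ≤ contSpace r)

/-- The product of a family of submodules as a submodule of the product. -/
def piEquivPi (r : ℕ) : (Submodule.pi Set.univ (raySpace r)) ≃ₗ[ℝ] (∀ k, raySpace r k) where
  toFun F k := ⟨F.1 k, F.2 k trivial⟩
  map_add' _ _ := rfl
  map_smul' _ _ := rfl
  invFun F := ⟨fun k => (F k).1, fun k _ => (F k).2⟩
  left_inv _ := rfl
  right_inv _ := rfl

lemma finrank_coordSpace_add (r : ℕ) :
    Module.finrank ℝ (coordSpace r) + Module.finrank ℝ (vertexSpace r) =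
      ∑ k, Module.finrank ℝ (raySpace r k) := by
  have : FiniteDimensional ℝ (Submodule.pi Set.univ (raySpace r)) :=
    (piEquivPi r).symm.finiteDimensional
  have h : (Submodule.pi Set.univ (raySpace r)).map
      (∑ k, LinearMap.proj k : (Fin 4 → Q4) →ₗ[ℝ] Q4) = vertexSpace r := by
    rw [← raySum_eq]
    refine le_antisymm ?_ (iSup_le fun k F hF => ⟨Pi.single k F, ?_, ?_⟩)
    · rintro _ ⟨F, hF, rfl⟩
      rw [LinearMap.sum_apply]
      exact Submodule.sum_mem _ fun k _ => mem_raySum k (hF k trivial)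
    · rintro j -
      rcases eq_or_ne j k with rfl | hj
      · simpa using hF
      · simp [hj]
    · simp
  rw [← Module.finrank_pi_fintype, ← (piEquivPi r).finrank_eq, ← h]
  exact finrank_inf_ker_add_finrank_map _ _

lemma finrank_coordSpace {r : ℕ} (hr : 1 ≤ r) : (Module.finrank ℝ (coordSpace r) : ℤ) =
    (r : ℤ) * (2 * (r : ℤ) ^ 2 - 3 * (r : ℤ) + 13) := by
  have h1 := finrank_coordSpace_add r
  have h2 := finrank_vertexSpace_add r
  have h3 := fun k => finrank_raySpace_add r k
  have h4 := fun k => card_rayExponents r k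
  have h5 := card_vertexExponents hr
  have h6 := card_contExponents r
  rw [← finrank_contSpace_eq_card] at h6
  have h7 := choose_add_four r
  have h8 : ∀ k, 2 * Module.finrank ℝ (raySpace r k) + 3 * r ^ 2 =
      2 * Module.finrank ℝ (contSpace r) + r := fun k => by
    have := h3 k
    have := h4 k
    omega
  rw [Fin.sum_univ_four] at h1
  have := h8 0
  have := h8 1
  have := h8 2
  have := h8 3
  zify at *
  linarith

/-- The edge vector from the barycenter to the vertex `x j`. -/
def spoke (x : Fin 4 → V3) (j : Fin 4) : V3 := x j - bary x

lemma sum_spoke (x : Fin 4 → V3) : ∑ j, spoke x j = 0 := by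
  funext c
  simp only [spoke, bary, Fin.sum_univ_four, Pi.add_apply, Pi.sub_apply, Pi.smul_apply,
    smul_eq_mul, Pi.zero_apply]
  ring

/-- Gradients of the barycentric coordinates of a nondegenerate tetrahedron. -/
lemma exists_baryGrad {x : Fin 4 → V3} (hx : AffineIndependent ℝ x) :
    ∃ g : Fin 4 → V3, (∀ m j, ∑ c, g m c * spoke x j c = if m = j then 3 / 4 else -1 / 4) ∧
      ∀ c d, ∑ m, g m c * spoke x m d = if c = d then 1 else 0 := by
  have htop : affineSpan ℝ (Set.range x) = ⊤ :=
    hx.affineSpan_eq_top_iff_card_eq_finrank_add_one.2 (by simp)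
  let b : AffineBasis (Fin 4) ℝ V3 := ⟨x, hx, htop⟩
  have hlin : ∀ m (u : V3), (b.coord m).linear u =
      ∑ c, (b.coord m).linear (Pi.single c 1) * u c := by
    intro m u
    conv_lhs => rw [pi_eq_sum_univ' u]
    simp only [map_sum, map_smul, smul_eq_mul]
    refine Finset.sum_congr rfl fun c _ => ?_
    rw [mul_comm]
  have hsub : ∀ m (p q : V3), (b.coord m).linear (p - q) = b.coord m p - b.coord m q := by
    intro m p q
    have := (b.coord m).linearMap_vsub p q
    simpa using this
  have hcoord : ∀ m j, b.coord m (x j) = if m = j then 1 else 0 := fun m j => b.coord_apply m j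
  have hspoke : ∀ m j, (b.coord m).linear (spoke x j) = if m = j then 3 / 4 else -1 / 4 := by
    intro m j
    have : spoke x j = (4 : ℝ)⁻¹ • ∑ k, (x j - x k) := by
      funext c
      simp only [spoke, bary, Fin.sum_univ_four, Pi.add_apply, Pi.sub_apply, Pi.smul_apply,
        smul_eq_mul]
      ring
    rw [this, map_smul, map_sum]
    simp only [hsub, hcoord, Finset.sum_sub_distrib, Finset.sum_const, Finset.card_univ,
      Fintype.card_fin, Finset.sum_ite_eq, Finset.mem_univ, if_true, smul_eq_mul, nsmul_eq_mul]
    split_ifs <;> norm_num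
  have hsum : ∀ u : V3, ∑ m, (b.coord m).linear u = 0 := by
    intro u
    have h1 : ∀ m, (b.coord m).linear u = b.coord m u - b.coord m 0 := by
      intro m; rw [← hsub, sub_zero]
    simp only [h1, Finset.sum_sub_distrib, b.sum_coord_apply_eq_one, sub_self]
  have hrec : ∀ u : V3, ∑ m, (b.coord m).linear u • spoke x m = u := by
    intro u
    have h1 : ∀ m, (b.coord m).linear u = b.coord m u - b.coord m 0 := by
      intro m; rw [← hsub, sub_zero]
    have h2 : ∑ m, b.coord m u • x m = u := b.linear_combination_coord_eq_self u
    have h3 : ∑ m, b.coord m (0 : V3) • x m = 0 := b.linear_combination_coord_eq_self 0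
    simp only [spoke, smul_sub, Finset.sum_sub_distrib, ← Finset.sum_smul, hsum, zero_smul,
      sub_zero]
    simp only [h1, sub_smul, Finset.sum_sub_distrib, h2, h3, sub_zero]
  refine ⟨fun m c => (b.coord m).linear (Pi.single c 1), ?_, ?_⟩
  · intro m j
    rw [← hlin, hspoke]
  · intro c d
    have := congrFun (hrec (Pi.single c 1)) d
    simpa [Finset.sum_apply, Pi.single_apply, eq_comm] using this

/-- Setting the variables in `S` to zero. -/
def kill (S : Finset (Fin 4)) : Q4 →ₐ[ℝ] Q4 := aeval fun m => if m ∈ S then 0 else X m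

lemma kill_monomial (S : Finset (Fin 4)) (β : Fin 4 →₀ ℕ) (a : ℝ) :
    kill S (monomial β a) = if ∀ m ∈ S, β m = 0 then monomial β a else 0 := by
  rw [kill, aeval_monomial]
  split_ifs with h
  · rw [monomial_eq, algebraMap_eq]
    congr 1
    refine Finset.prod_congr rfl fun m hm => ?_
    have : m ∉ S := fun hS => (Finsupp.mem_support_iff.1 hm) (h m hS)
    simp only [if_neg this]
  · push Not at h
    obtain ⟨m, hS, hm⟩ := h
    rw [Finsupp.prod, Finset.prod_eq_zero (Finsupp.mem_support_iff.2 hm), mul_zero]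
    rw [if_pos hS, zero_pow hm]

lemma coeff_kill (S : Finset (Fin 4)) (α : Fin 4 →₀ ℕ) (F : Q4) :
    coeff α (kill S F) = if ∀ m ∈ S, α m = 0 then coeff α F else 0 := by
  induction F using MvPolynomial.induction_on' with
  | monomial β a =>
    rw [kill_monomial]
    by_cases h : β = α
    · subst h; split_ifs <;> simp
    · split_ifs <;> simp [coeff_monomial, h]
  | add p q hp hq =>
    rw [map_add, coeff_add, hp, hq, coeff_add]
    split_ifs <;> simp

lemma kill_eq_zero_iff {S : Finset (Fin 4)} {F : Q4} :
    kill S F = 0 ↔ ∀ α : Fin 4 →₀ ℕ, (∀ m ∈ S, α m = 0) → coeff α F = 0 := by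
  refine ⟨fun h α hα => ?_, fun h => ?_⟩
  · rw [← coeff_zero α, ← h, coeff_kill, if_pos hα]
  · ext α
    rw [coeff_kill, coeff_zero]
    split_ifs with hα
    · exact h α hα
    · rfl

lemma totalDegree_aeval_le {σ τ : Type*} (f : σ → MvPolynomial τ ℝ)
    (hf : ∀ i, (f i).totalDegree ≤ 1) (p : MvPolynomial σ ℝ) :
    (aeval f p).totalDegree ≤ p.totalDegree := by
  rw [aeval_def, eval₂_eq]
  refine totalDegree_finsetSum_le fun α hα => ?_
  refine (totalDegree_mul _ _).trans ?_
  rw [algebraMap_eq, totalDegree_C, zero_add]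
  refine (totalDegree_finsetProd _ _).trans ?_
  refine le_trans (Finset.sum_le_sum fun i _ => ?_) (le_totalDegree hα)
  exact (totalDegree_pow _ _).trans (by simpa using Nat.mul_le_mul_left (α i) (hf i))

/-- The difference of the barycentric coordinates with gradients `g m` and `g i`, when both
coordinates agree at `z`. -/
def coordDiff (z : V3) (g : Fin 4 → V3) (i m : Fin 4) : P3 :=
  ∑ c, C (g m c - g i c) * (X c - C (z c))

/-- Substitution of the coordinates of the cell `T_i` in a polynomial. -/
def toCell (z : V3) (g : Fin 4 → V3) (i : Fin 4) : Q4 →ₐ[ℝ] P3 := aeval (coordDiff z g i)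

/-- Pullback along `y ↦ z + ∑ m, y m • v m`. -/
def pullback (z : V3) (v : Fin 4 → V3) : P3 →ₐ[ℝ] Q4 :=
  aeval fun c => C (z c) + ∑ m, C (v m c) * X m

section
variable (z : V3) (g v : Fin 4 → V3)

lemma totalDegree_linear_le {σ : Type*} (c : ℝ) (p : MvPolynomial σ ℝ)
    (hp : p.totalDegree ≤ 1) : (C c * p).totalDegree ≤ 1 := by
  refine (totalDegree_mul _ _).trans ?_
  rwa [totalDegree_C, zero_add]

lemma totalDegree_toCell_le (i : Fin 4) (F : Q4) :
    (toCell z g i F).totalDegree ≤ F.totalDegree := by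
  refine totalDegree_aeval_le _ (fun m => ?_) F
  refine totalDegree_finsetSum_le fun c _ => totalDegree_linear_le _ _ ?_
  refine (totalDegree_sub _ _).trans ?_
  simp

lemma totalDegree_pullback_le (f : P3) : (pullback z v f).totalDegree ≤ f.totalDegree := by
  refine totalDegree_aeval_le _ (fun c => ?_) f
  refine (totalDegree_add _ _).trans (max_le (by simp) ?_)
  exact totalDegree_finsetSum_le fun m _ => totalDegree_linear_le _ _ (by simp)

variable {z g v}

lemma toCell_pullback (hv : ∑ m, v m = 0)
    (hrec : ∀ c d, ∑ m, g m c * v m d = if c = d then 1 else 0) (i : Fin 4) (f : P3) :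
    toCell z g i (pullback z v f) = f := by
  have : (toCell z g i).comp (pullback z v) = AlgHom.id ℝ P3 := by
    ext1 c
    have hv' : ∑ m, v m c = 0 := by simpa using congrFun hv c
    simp only [AlgHom.comp_apply, pullback, toCell, aeval_X, map_add, map_sum, map_mul,
      algHom_C, algebraMap_eq, AlgHom.id_apply, coordDiff]
    have h1 : ∀ m, C (v m c) * ∑ d, C (g m d - g i d) * (X d - C (z d)) =
        ∑ d, C (g m d * v m c - g i d * v m c) * (X d - C (z d) : P3) := by
      intro m
      rw [Finset.mul_sum]
      refine Finset.sum_congr rfl fun d _ => ?_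
      simp only [map_sub, map_mul]; ring
    simp only [h1]
    rw [Finset.sum_comm]
    simp only [← Finset.sum_mul, ← map_sum, Finset.sum_sub_distrib, hrec, ← Finset.mul_sum, hv',
      mul_zero, sub_zero]
    rw [Finset.sum_eq_single c]
    · simp
    · intro d _ hd; simp [hd]
    · simp
  exact DFunLike.congr_fun this f

lemma pullback_coordDiff
    (hgv : ∀ m j, ∑ c, g m c * v j c = if m = j then 3 / 4 else -1 / 4) (i m : Fin 4) :
    pullback z v (coordDiff z g i m) = X m - X i := by
  have h0 : ∀ c, pullback z v (X c - C (z c)) = ∑ n, C (v n c) * X n := by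
    intro c
    rw [map_sub, pullback, aeval_X, algHom_C, algebraMap_eq, add_sub_cancel_left]
  simp only [coordDiff, map_sum, map_mul, h0]
  simp only [algHom_C, algebraMap_eq]
  have h1 : ∀ c, C (g m c - g i c) * ∑ n, C (v n c) * X n =
      ∑ n, C (g m c * v n c - g i c * v n c) * (X n : Q4) := by
    intro c
    rw [Finset.mul_sum]
    refine Finset.sum_congr rfl fun d _ => ?_
    simp only [map_sub, map_mul]; ring
  simp only [h1]
  rw [Finset.sum_comm]
  simp only [← Finset.sum_mul, ← map_sum, Finset.sum_sub_distrib, hgv]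
  have h2 : ∀ n, C ((if m = n then 3 / 4 else -1 / 4) - (if i = n then 3 / 4 else -1 / 4 : ℝ)) *
      (X n : Q4) = (if m = n then X n else 0) - (if i = n then X n else 0) := by
    intro n
    split_ifs <;> norm_num
  simp only [h2, Finset.sum_sub_distrib, Finset.sum_ite_eq, Finset.mem_univ, if_true]

lemma kill_pullback_toCell
    (hgv : ∀ m j, ∑ c, g m c * v j c = if m = j then 3 / 4 else -1 / 4)
    {S : Finset (Fin 4)} {i : Fin 4} (hi : i ∈ S) (F : Q4) :
    kill S (pullback z v (toCell z g i F)) = kill S F := by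
  have : (kill S).comp ((pullback z v).comp (toCell z g i)) = kill S := by
    ext1 m
    simp only [AlgHom.comp_apply, toCell, aeval_X, pullback_coordDiff hgv]
    simp only [map_sub, kill, aeval_X, hi, if_true, sub_zero]
  exact DFunLike.congr_fun this F

lemma toCell_kill (i : Fin 4) (F : Q4) : toCell z g i (kill {i} F) = toCell z g i F := by
  have : (toCell z g i).comp (kill {i}) = toCell z g i := by
    ext1 m
    simp only [AlgHom.comp_apply, toCell, aeval_X, kill, Finset.mem_singleton]
    split_ifs with h
    · subst h; simp [coordDiff]
    · rw [aeval_X]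
  exact DFunLike.congr_fun this F

lemma pderiv_toCell (i : Fin 4) (c : Fin 3) (F : Q4) :
    pderiv c (toCell z g i F) = ∑ m, toCell z g i (pderiv m F) * C (g m c - g i c) := by
  have hX : ∀ m, pderiv c (coordDiff z g i m) = C (g m c - g i c) := by
    intro m
    have hd : ∀ d, pderiv c (X d - C (z d) : P3) = pderiv c (X d) := by
      intro d
      rw [map_sub, pderiv_C, sub_zero]
    simp only [coordDiff, map_sum, Derivation.leibniz, hd, pderiv_C, smul_eq_mul, mul_zero,
      add_zero]
    rw [Finset.sum_eq_single c]
    · simp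
    · intro d _ hd; simp [pderiv_X_of_ne hd]
    · simp
  induction F using MvPolynomial.induction_on with
  | C a => simp [toCell, algHom_C]
  | add p q hp hq => simp only [map_add, hp, hq, add_mul, Finset.sum_add_distrib]
  | mul_X p n hp =>
    simp only [map_mul, Derivation.leibniz, map_add, hp, smul_eq_mul]
    have h1 : toCell z g i (X n) = coordDiff z g i n := by rw [toCell, aeval_X]
    rw [h1, hX]
    simp only [add_mul, Finset.sum_add_distrib, Finset.mul_sum]
    congr 1
    · rw [Finset.sum_eq_single n]
      · simp
      · intro d _ hd; simp [pderiv_X_of_ne hd.symm]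
      · simp
    · exact Finset.sum_congr rfl fun m _ => by ring

end

lemma eval_pullback (z : V3) (v : Fin 4 → V3) (y : Fin 4 → ℝ) (q : P3) :
    eval y (pullback z v q) = eval (z + ∑ m, y m • v m) q := by
  rw [pullback, ← aeval_eq_eval, ← aeval_eq_eval]
  rw [← AlgHom.comp_apply, comp_aeval]
  congr 2
  funext c
  simp [aeval_eq_eval, Finset.sum_apply, mul_comm]

lemma eval_kill (S : Finset (Fin 4)) (y : Fin 4 → ℝ) (G : Q4) :
    eval y (kill S G) = eval (fun m => if m ∈ S then 0 else y m) G := by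
  rw [kill, ← aeval_eq_eval, ← aeval_eq_eval]
  rw [← AlgHom.comp_apply, comp_aeval]
  congr 2
  funext c
  split_ifs <;> simp [aeval_eq_eval]

lemma mem_intFace {x : Fin 4 → V3} {i j : Fin 4} {y : Fin 4 → ℝ}
    (hy : ∀ m, y m ∈ Set.Icc (0 : ℝ) (1 / 4)) (hi : y i = 0) (hj : y j = 0) :
    bary x + ∑ m, y m • spoke x m ∈ intFace x i j := by
  have hconv : Convex ℝ (intFace x i j) := convex_convexHull ℝ _
  have hz : bary x ∈ intFace x i j := subset_convexHull ℝ _ (Set.mem_insert _ _)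
  have hm : ∀ m, bary x + (4 * y m) • (x m - bary x) ∈ intFace x i j := by
    intro m
    by_cases h : m ≠ i ∧ m ≠ j
    · refine hconv.add_smul_sub_mem hz
        (subset_convexHull ℝ _ (Set.mem_insert_of_mem _ ⟨m, h, rfl⟩)) ⟨?_, ?_⟩
      · linarith [(hy m).1]
      · linarith [(hy m).2]
    · have : y m = 0 := by
        by_cases hmi : m = i
        · rw [hmi, hi]
        · rw [show m = j by tauto, hj]
      simpa [this] using hz
  have := hconv.sum_mem (t := Finset.univ) (w := fun _ : Fin 4 => (1 / 4 : ℝ))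
    (fun _ _ => by norm_num) (by norm_num) fun m _ => hm m
  convert this using 1
  funext c
  simp only [spoke, Fin.sum_univ_four, Pi.add_apply, Pi.sub_apply, Pi.smul_apply, smul_eq_mul]
  ring

lemma exists_of_mem_intFace {x : Fin 4 → V3} {i j : Fin 4} {w : V3} (hw : w ∈ intFace x i j) :
    ∃ y : Fin 4 → ℝ, y i = 0 ∧ y j = 0 ∧ w = bary x + ∑ m, y m • spoke x m := by
  have hsub : intFace x i j ⊆
      {w | ∃ y : Fin 4 → ℝ, y i = 0 ∧ y j = 0 ∧ w = bary x + ∑ m, y m • spoke x m} := by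
    refine convexHull_min ?_ ?_
    · rintro w (rfl | ⟨k, ⟨hki, hkj⟩, rfl⟩)
      · exact ⟨0, by simp⟩
      · refine ⟨Pi.single k 1, by simp [hki.symm], by simp [hkj.symm], ?_⟩
        simp [Pi.single_apply, ite_smul, spoke]
    · rintro _ ⟨y, hi, hj, rfl⟩ _ ⟨y', hi', hj', rfl⟩ a b _ _ hab
      refine ⟨a • y + b • y', by simp [hi, hi'], by simp [hj, hj'], ?_⟩
      funext c
      simp only [Fin.sum_univ_four, Pi.add_apply, Pi.smul_apply, smul_eq_mul]
      linear_combination (bary x c) * hab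
  exact hsub hw

/-- A polynomial vanishes on an interior face exactly when its pullback vanishes on the
corresponding coordinate plane. -/
lemma forall_intFace_eval_eq_zero_iff {x : Fin 4 → V3} {i j : Fin 4} {q : P3} :
    (∀ w ∈ intFace x i j, eval w q = 0) ↔ kill {i, j} (pullback (bary x) (spoke x) q) = 0 := by
  constructor
  · intro h
    refine funext_set (fun _ => Set.Icc (0 : ℝ) (1 / 4))
      (fun _ => Set.Icc_infinite (by norm_num)) ?_
    intro y hy
    rw [eval_kill, eval_pullback, map_zero]
    refine h _ (mem_intFace (fun m => ?_) (by simp) (by simp))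
    split_ifs
    · norm_num
    · exact hy m (Set.mem_univ m)
  · intro h w hw
    obtain ⟨y, hi, hj, rfl⟩ := exists_of_mem_intFace hw
    rw [← eval_pullback]
    have h1 := eval_kill {i, j} y (pullback (bary x) (spoke x) q)
    rw [h, map_zero] at h1
    rw [h1]
    congr 2
    funext m
    split_ifs with hm
    · rw [Finset.mem_insert, Finset.mem_singleton] at hm
      rcases hm with rfl | rfl <;> assumption
    · rfl

lemma mem_H1CurlSpace {r : ℕ} {x : Fin 4 → V3} {p : Fin 4 → VP3} :
    p ∈ H1CurlSpace r x ↔ (∀ i c, (p i c).totalDegree ≤ r) ∧ ∀ i j, i ≠ j → ∀ c,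
      kill {i, j} (pullback (bary x) (spoke x) (p i c - p j c)) = 0 ∧
      kill {i, j} (pullback (bary x) (spoke x) (pcurl (p i) c - pcurl (p j) c)) = 0 := by
  simp only [← forall_intFace_eval_eq_zero_iff]
  simp only [map_sub, sub_eq_zero]
  change (_ ∧ ∀ i j, i ≠ j → ∀ y ∈ intFace x i j,
      evalV (p i) y = evalV (p j) y ∧ evalV (pcurl (p i)) y = evalV (pcurl (p j)) y) ↔ _
  simp only [funext_iff, evalV, degVle]
  grind

section
variable {z : V3} {g v : Fin 4 → V3}

/-- The piecewise field with `∇λₖ`-components `F k`, cell by cell. -/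
def assemble (z : V3) (g : Fin 4 → V3) : (Fin 4 → Q4) →ₗ[ℝ] (Fin 4 → VP3) where
  toFun F i c := ∑ k, C (g k c) * toCell z g i (F k)
  map_add' F F' := by
    funext i c
    simp [mul_add, Finset.sum_add_distrib]
  map_smul' a F := by
    funext i c
    simp [Finset.smul_sum]

lemma assemble_apply (F : Fin 4 → Q4) (i : Fin 4) (c : Fin 3) :
    assemble z g F i c = ∑ k, C (g k c) * toCell z g i (F k) := rfl

lemma kill_pullback_assemble
    (hgv : ∀ m j, ∑ c, g m c * v j c = if m = j then 3 / 4 else -1 / 4)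
    (F : Fin 4 → Q4) {S : Finset (Fin 4)} {i : Fin 4} (hi : i ∈ S) (c : Fin 3) :
    kill S (pullback z v (assemble z g F i c)) = ∑ k, C (g k c) * kill S (F k) := by
  simp only [assemble_apply, map_sum, map_mul, algHom_C, algebraMap_eq,
    kill_pullback_toCell hgv hi]

lemma kill_pullback_pderiv_assemble
    (hgv : ∀ m j, ∑ c, g m c * v j c = if m = j then 3 / 4 else -1 / 4)
    (F : Fin 4 → Q4) {S : Finset (Fin 4)} {i : Fin 4} (hi : i ∈ S) (d e : Fin 3) :
    kill S (pullback z v (pderiv d (assemble z g F i e))) =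
      ∑ k, C (g k e) * (∑ m, kill S (pderiv m (F k)) * C (g m d) -
        C (g i d) * kill S (sumD (F k))) := by
  have h : pderiv d (assemble z g F i e) = ∑ k, C (g k e) *
      ∑ m, toCell z g i (pderiv m (F k)) * C (g m d - g i d) := by
    simp only [assemble_apply, map_sum, pderiv_C_mul, pderiv_toCell]
  rw [h]
  simp only [map_sum, map_mul, algHom_C, algebraMap_eq, kill_pullback_toCell hgv hi, sumD_apply]
  refine Finset.sum_congr rfl fun k _ => ?_
  rw [Finset.mul_sum (s := Finset.univ) (a := C (g i d)), ← Finset.sum_sub_distrib]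
  congr 1
  refine Finset.sum_congr rfl fun m _ => ?_
  rw [C_sub]
  ring

lemma kill_pullback_pcurl_assemble
    (hgv : ∀ m j, ∑ c, g m c * v j c = if m = j then 3 / 4 else -1 / 4)
    (F : Fin 4 → Q4) (i j : Fin 4) (c : Fin 3) :
    kill {i, j} (pullback z v (pcurl (assemble z g F i) c - pcurl (assemble z g F j) c)) =
      C (g j (c + 1) - g i (c + 1)) * ∑ k, C (g k (c + 2)) * kill {i, j} (sumD (F k)) -
      C (g j (c + 2) - g i (c + 2)) * ∑ k, C (g k (c + 1)) * kill {i, j} (sumD (F k)) := by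
  have h : ∀ d e, kill {i, j} (pullback z v (pderiv d (assemble z g F i e))) -
      kill {i, j} (pullback z v (pderiv d (assemble z g F j e))) =
      C (g j d - g i d) * ∑ k, C (g k e) * kill {i, j} (sumD (F k)) := by
    intro d e
    rw [kill_pullback_pderiv_assemble hgv F (by simp), kill_pullback_pderiv_assemble hgv F (by simp),
      ← Finset.sum_sub_distrib, Finset.mul_sum]
    refine Finset.sum_congr rfl fun k _ => ?_
    rw [C_sub]
    ring
  simp only [pcurl, map_sub (kill _), map_sub (pullback z v)]
  rw [← h, ← h]
  ring

lemma sum_spoke_mul_sum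
    (hgv : ∀ m j, ∑ c, g m c * v j c = if m = j then 3 / 4 else -1 / 4) {σ : Type*}
    {G : Fin 4 → MvPolynomial σ ℝ} (hG : ∑ k, G k = 0) (k : Fin 4) :
    ∑ c, C (v k c) * ∑ m, C (g m c) * G m = G k := by
  have h1 : ∑ c, C (v k c) * ∑ m, C (g m c) * G m = ∑ m, C (∑ c, g m c * v k c) * G m := by
    simp only [Finset.mul_sum, map_sum, Finset.sum_mul, map_mul]
    rw [Finset.sum_comm]
    exact Finset.sum_congr rfl fun m _ => Finset.sum_congr rfl fun c _ => by ring
  have h2 : ∀ m, C (if m = k then 3 / 4 else -1 / 4 : ℝ) * G m =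
      (if m = k then G m else 0) - C (1 / 4) * G m := by
    intro m
    split_ifs
    · rw [show (3 / 4 : ℝ) = 1 - 1 / 4 by norm_num, C_sub, C_1]; ring
    · rw [show (-1 / 4 : ℝ) = - (1 / 4) by norm_num, C_neg]; ring
  rw [h1]
  simp only [hgv, h2, Finset.sum_sub_distrib, ← Finset.mul_sum, hG]
  simp

/-- For `∑ k, G k = 0`, the vector `∑ k, G k • g k` is parallel to `g j - g i` exactly when
only `G i` and `G j` can be nonzero. -/
lemma cross_sum_eq_zero_iff
    (hgv : ∀ m j, ∑ c, g m c * v j c = if m = j then 3 / 4 else -1 / 4)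
    {G : Fin 4 → Q4} (hG : ∑ k, G k = 0) {i j : Fin 4} (hij : i ≠ j) :
    (∀ c : Fin 3, C (g j (c + 1) - g i (c + 1)) * ∑ k, C (g k (c + 2)) * G k -
      C (g j (c + 2) - g i (c + 2)) * ∑ k, C (g k (c + 1)) * G k = 0) ↔
      ∀ k, k ≠ i → k ≠ j → G k = 0 := by
  constructor
  · intro h k hki hkj
    have hk := sum_spoke_mul_sum hgv hG k
    have hn0 : ∑ c, C (v k c) * C (g j c - g i c) = (0 : Q4) := by
      rw [← C_0 (σ := Fin 4)]
      simp only [← C_mul, ← map_sum]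
      congr 1
      have h1 := hgv j k
      have h2 := hgv i k
      rw [if_neg hkj.symm] at h1
      rw [if_neg hki.symm] at h2
      simp only [mul_comm (v k _), sub_mul, Finset.sum_sub_distrib, h1, h2, sub_self]
    have hn1 : ∑ c, C (v j c) * C (g j c - g i c) = (1 : Q4) := by
      rw [← C_1 (σ := Fin 4)]
      simp only [← C_mul, ← map_sum]
      congr 1
      have h1 := hgv j j
      have h2 := hgv i j
      rw [if_pos rfl] at h1
      rw [if_neg hij] at h2
      simp only [mul_comm (v j _), sub_mul, Finset.sum_sub_distrib, h1, h2]
      norm_num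
    generalize hn : (fun c => C (g j c - g i c) : Fin 3 → Q4) = n at *
    generalize hh : (fun c => ∑ k, C (g k c) * G k : Fin 3 → Q4) = h' at *
    have en : ∀ c, C (g j c - g i c) = n c := fun c => congrFun hn c
    have eh : ∀ c, ∑ k, C (g k c) * G k = h' c := fun c => congrFun hh c
    simp only [en, eh, Fin.sum_univ_three] at h hk hn0 hn1
    have h0 := h 0
    have h1 := h 1
    have h2 := h 2
    simp only [show (0 : Fin 3) + 1 = 1 from rfl, show (0 : Fin 3) + 2 = 2 from rfl,
      show (1 : Fin 3) + 1 = 2 from rfl, show (1 : Fin 3) + 2 = 0 from rfl,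
      show (2 : Fin 3) + 1 = 0 from rfl, show (2 : Fin 3) + 2 = 1 from rfl] at h0 h1 h2
    linear_combination (C (v j 1) * C (v k 2) - C (v j 2) * C (v k 1)) * h0 +
      (C (v j 2) * C (v k 0) - C (v j 0) * C (v k 2)) * h1 +
      (C (v j 0) * C (v k 1) - C (v j 1) * C (v k 0)) * h2 - G k * hn1
      + (C (v j 0) * h' 0 + C (v j 1) * h' 1 + C (v j 2) * h' 2) * hn0
      - (C (v j 0) * n 0 + C (v j 1) * n 1 + C (v j 2) * n 2) * hk
  · intro h c
    have h2 : ∀ f : Fin 4 → Q4, ∑ k, f k * G k = f i * G i + f j * G j := fun f =>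
      Fintype.sum_eq_add i j hij fun k hk => by rw [h k hk.1 hk.2, mul_zero]
    have h3 : G i + G j = 0 := by
      rw [← hG]
      exact (Fintype.sum_eq_add i j hij fun k hk => h k hk.1 hk.2).symm
    simp only [h2, C_sub]
    linear_combination (C (g j (c + 1)) * C (g i (c + 2)) - C (g i (c + 1)) * C (g j (c + 2))) * h3

end

lemma forall_kill_eq_zero_iff {k : Fin 4} {G : Q4} :
    (∀ i j, i ≠ j → k ≠ i → k ≠ j → kill {i, j} G = 0) ↔ G ∈ vanishNear k := by
  simp only [mem_vanishNear, kill_eq_zero_iff, NearRay, Finset.mem_insert, Finset.mem_singleton,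
    forall_eq_or_imp, forall_eq]
  constructor
  · rintro h β ⟨i, j, hij, hi, hj, h0⟩
    exact h i j hij hi.symm hj.symm β h0
  · intro h i j hij hi hj β h0
    exact h β ⟨i, j, hij, hi.symm, hj.symm, h0⟩

lemma totalDegree_le_of_mem_contSpace {r : ℕ} {F : Q4} (hF : F ∈ contSpace r) :
    F.totalDegree ≤ r :=
  Finset.sup_le fun α hα => (mem_contSpace.1 hF α (mem_support_iff.1 hα)).1

lemma assemble_mem_iff {r : ℕ} {x g : Fin 4 → V3}
    (hgv : ∀ m j, ∑ c, g m c * spoke x j c = if m = j then 3 / 4 else -1 / 4)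
    {F : Fin 4 → Q4} (hF : ∀ k, F k ∈ contSpace r) (hsum : ∑ k, F k = 0) :
    assemble (bary x) g F ∈ H1CurlSpace r x ↔ F ∈ coordSpace r := by
  have hdeg : ∀ i c, (assemble (bary x) g F i c).totalDegree ≤ r := fun i c =>
    totalDegree_finsetSum_le fun k _ => by
      refine (totalDegree_mul _ _).trans ?_
      rw [totalDegree_C, zero_add]
      exact (totalDegree_toCell_le _ _ _ _).trans (totalDegree_le_of_mem_contSpace (hF k))
  have hcont : ∀ i j c, kill {i, j} (pullback (bary x) (spoke x)
      (assemble (bary x) g F i c - assemble (bary x) g F j c)) = 0 := by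
    intro i j c
    rw [map_sub, map_sub, kill_pullback_assemble hgv F (by simp),
      kill_pullback_assemble hgv F (by simp), sub_self]
  have hG : ∀ S, ∑ k, kill S (sumD (F k)) = 0 := by
    intro S
    rw [← map_sum, ← map_sum, hsum, map_zero, map_zero]
  rw [mem_H1CurlSpace, mem_coordSpace]
  simp only [hdeg, hcont, hsum, hF, mem_raySpace, ← forall_kill_eq_zero_iff, true_and, and_true,
    implies_true, kill_pullback_pcurl_assemble hgv]
  constructor
  · intro h k i j hij hi hj
    exact (cross_sum_eq_zero_iff hgv (hG _) hij).1 (h i j hij) k hi hj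
  · intro h i j hij
    exact (cross_sum_eq_zero_iff hgv (hG _) hij).2 fun k hi hj => h k i j hij hi hj

lemma eq_zero_of_kill_eq_zero {r : ℕ} {F : Q4} (hF : F ∈ contSpace r)
    (h : ∀ i, kill {i} F = 0) : F = 0 := by
  ext α
  by_contra hα
  obtain ⟨-, i, hi⟩ := mem_contSpace.1 hF α hα
  exact hα (kill_eq_zero_iff.1 (h i) α (by simpa using hi))

lemma assemble_eq_zero {r : ℕ} {z : V3} {g v : Fin 4 → V3}
    (hgv : ∀ m j, ∑ c, g m c * v j c = if m = j then 3 / 4 else -1 / 4)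
    {F : Fin 4 → Q4} (hF : ∀ k, F k ∈ contSpace r) (hsum : ∑ k, F k = 0)
    (h : assemble z g F = 0) : F = 0 := by
  funext k
  refine eq_zero_of_kill_eq_zero (hF k) fun i => ?_
  have hs : ∑ m, toCell z g i (F m) = 0 := by rw [← map_sum, hsum, map_zero]
  have h1 := sum_spoke_mul_sum hgv hs k
  simp only [← assemble_apply, h, Pi.zero_apply, mul_zero, Finset.sum_const_zero] at h1
  rw [← kill_pullback_toCell (z := z) hgv (Finset.mem_singleton_self i), ← h1, map_zero, map_zero]

/-- Polynomials on the cells that agree on the interior faces come from one element of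
`contSpace`. -/
lemma exists_glue {r : ℕ} {f : Fin 4 → Q4} (hdeg : ∀ i, (f i).totalDegree ≤ r)
    (hf : ∀ i j, i ≠ j → kill {i, j} (f i) = kill {i, j} (f j)) :
    ∃ F ∈ contSpace r, ∀ i, kill {i} F = kill {i} (f i) := by
  classical
  let a : (Fin 4 →₀ ℕ) → ℝ := fun α => if h : ∃ i, α i = 0 then coeff α (f h.choose) else 0
  have ha : ∀ α i, α i = 0 → a α = coeff α (f i) := by
    intro α i hi
    have h : ∃ i, α i = 0 := ⟨i, hi⟩
    have hc := h.choose_spec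
    simp only [a, dif_pos h]
    by_cases hne : h.choose = i
    · rw [hne]
    · have := congrArg (coeff α) (hf _ _ hne)
      simpa [coeff_kill, hi, hc] using this
  have hcoeff : ∀ α, coeff α (∑ β ∈ (finite_exponents r).toFinset, monomial β (a β)) =
      if α.degree ≤ r then a α else 0 := by
    intro α
    simp [coeff_sum, coeff_monomial]
  refine ⟨∑ β ∈ (finite_exponents r).toFinset, monomial β (a β), ?_, ?_⟩
  · rw [mem_contSpace]
    intro α hα
    rw [hcoeff] at hα
    by_cases h : α.degree ≤ r
    · refine ⟨h, ?_⟩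
      by_contra h'
      simp [h, a, h'] at hα
    · simp [h] at hα
  · intro i
    ext α
    simp only [coeff_kill, Finset.mem_singleton, forall_eq, hcoeff]
    split_ifs with hi h
    · exact ha α i hi
    · by_contra hne
      exact h ((le_totalDegree (mem_support_iff.2 (Ne.symm hne))).trans (hdeg i))
    · rfl

lemma exists_assemble_eq {r : ℕ} {x g : Fin 4 → V3}
    (hrec : ∀ c d, ∑ m, g m c * spoke x m d = if c = d then 1 else 0)
    {p : Fin 4 → VP3} (hp : p ∈ H1CurlSpace r x) :
    ∃ F : Fin 4 → Q4, (∀ k, F k ∈ contSpace r) ∧ ∑ k, F k = 0 ∧ assemble (bary x) g F = p := by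
  rw [mem_H1CurlSpace] at hp
  obtain ⟨hdeg, hp⟩ := hp
  have hv := sum_spoke x
  let q : Fin 4 → Fin 4 → P3 := fun k i => ∑ c, C (spoke x k c) * p i c
  have hglue : ∀ k, ∃ F ∈ contSpace r, ∀ i,
      kill {i} F = kill {i} (pullback (bary x) (spoke x) (q k i)) := by
    intro k
    refine exists_glue (fun i => ?_) fun i j hij => ?_
    · refine (totalDegree_pullback_le _ _ _).trans (totalDegree_finsetSum_le fun c _ => ?_)
      refine (totalDegree_mul _ _).trans ?_
      rw [totalDegree_C, zero_add]
      exact hdeg i c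
    · simp only [q, map_sum, map_mul]
      refine Finset.sum_congr rfl fun c _ => ?_
      have := (hp i j hij c).1
      rw [map_sub, map_sub, sub_eq_zero] at this
      rw [this]
  choose F hF hFq using hglue
  refine ⟨F, hF, ?_, ?_⟩
  · refine eq_zero_of_kill_eq_zero (Submodule.sum_mem _ fun k _ => hF k) fun i => ?_
    have hq : ∑ k, q k i = 0 := by
      simp only [q]
      rw [Finset.sum_comm]
      refine Finset.sum_eq_zero fun c _ => ?_
      rw [← Finset.sum_mul, ← map_sum]
      have : ∑ k, spoke x k c = 0 := by simpa using congrFun hv c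
      rw [this, C_0, zero_mul]
    rw [map_sum]
    simp only [hFq]
    rw [← map_sum, ← map_sum, hq, map_zero, map_zero]
  · funext i c
    rw [assemble_apply]
    have h1 : ∀ k, toCell (bary x) g i (F k) = q k i := by
      intro k
      rw [← toCell_kill, hFq, toCell_kill, toCell_pullback hv hrec]
    simp only [h1, q, Finset.mul_sum]
    rw [Finset.sum_comm]
    simp only [← mul_assoc, ← C_mul, ← Finset.sum_mul, ← map_sum, hrec]
    rw [Finset.sum_eq_single c]
    · simp
    · intro d _ hd; simp [hd.symm]
    · simp

lemma finrank_H1CurlSpace (r : ℕ) {x : Fin 4 → V3} (hx : AffineIndependent ℝ x) :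
    Module.finrank ℝ (H1CurlSpace r x) = Module.finrank ℝ (coordSpace r) := by
  obtain ⟨g, hgv, hrec⟩ := exists_baryGrad hx
  have hcoord : ∀ F ∈ coordSpace r, (∀ k, F k ∈ contSpace r) ∧ ∑ k, F k = 0 := fun F hF => by
    rw [mem_coordSpace] at hF
    exact ⟨fun k => (mem_raySpace.1 (hF.1 k)).1, hF.2⟩
  have hmap : (coordSpace r).map (assemble (bary x) g) = H1CurlSpace r x := by
    ext p
    rw [Submodule.mem_map]
    constructor
    · rintro ⟨F, hF, rfl⟩
      exact (assemble_mem_iff hgv (hcoord F hF).1 (hcoord F hF).2).2 hF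
    · intro hp
      obtain ⟨F, hF, hsum, rfl⟩ := exists_assemble_eq hrec hp
      exact ⟨F, (assemble_mem_iff hgv hF hsum).1 hp, rfl⟩
  have hinj : Function.Injective ((assemble (bary x) g).domRestrict (coordSpace r)) := by
    refine (injective_iff_map_eq_zero _).2 ?_
    rintro ⟨F, hF⟩ h0
    exact Subtype.ext (assemble_eq_zero hgv (hcoord F hF).1 (hcoord F hF).2 h0)
  rw [← LinearMap.finrank_range_of_inj hinj, LinearMap.range_domRestrict, hmap]

end Alfeld

/-- for `r ≥ 1`, the space of piecewise polynomial vector fields of degree at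
most `r` on an Alfeld split such that the field and its curl are continuous across the
interior faces has dimension `r (2 r² - 3 r + 13)`. -/
theorem statement14 (r : ℕ) (hr : 1 ≤ r) (x : Fin 4 → V3)
    (hx : AffineIndependent ℝ x) :
    (Module.finrank ℝ (H1CurlSpace r x) : ℤ) =
      (r : ℤ) * (2 * (r : ℤ) ^ 2 - 3 * (r : ℤ) + 13) := by
  rw [finrank_H1CurlSpace r hx, finrank_coordSpace hr]
end
end

section
/- For all integers n ≥ 2 and r ≥ 1, the following binomial identity holds: (n+1)·C(r−1, n) + ∑_{s=0}^{n−1} C(n+2, s+1)·C(r−1, s) = C(r+n+1, n+1) − C(r, n+1). (This identity expresses that the dimension of the space of continuous piecewise polynomials of degree ≤ r on the Alfeld split of an n-simplex, counted via the simplices of the split, equals C(r+n+1, n+1) − C(r, n+1).) -/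
/-- Vandermonde's identity, summed over `range` and with one binomial coefficient reflected. -/
theorem sum_range_choose_succ_mul_choose (n m : ℕ) :
    ∑ s ∈ Finset.range (n + 2), (n + 2).choose (s + 1) * m.choose s =
      (m + n + 2).choose (n + 1) := by
  rw [add_assoc, Nat.add_choose_eq, Finset.Nat.sum_antidiagonal_eq_sum_range_succ_mk]
  refine Finset.sum_congr rfl fun s hs => ?_
  have hs' : s < n + 2 := Finset.mem_range.mp hs
  rw [mul_comm, Nat.choose_symm_of_eq_add (show n + 2 = (s + 1) + (n + 1 - s) by omega)]

/-- for `n ≥ 2` and `r ≥ 1`,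
`(n+1)·C(r−1, n) + ∑_{s=0}^{n−1} C(n+2, s+1)·C(r−1, s) = C(r+n+1, n+1) − C(r, n+1)`. -/
theorem statement15 (n r : ℕ) (hn : 2 ≤ n) (hr : 1 ≤ r) :
    ((n : ℤ) + 1) * (Nat.choose (r - 1) n : ℤ) +
        ∑ s ∈ Finset.range n, (Nat.choose (n + 2) (s + 1) : ℤ) * (Nat.choose (r - 1) s : ℤ) =
      (Nat.choose (r + n + 1) (n + 1) : ℤ) - (Nat.choose r (n + 1) : ℤ) := by
  obtain ⟨m, rfl⟩ := Nat.exists_eq_add_of_le' hr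
  have h := sum_range_choose_succ_mul_choose n m
  rw [Finset.sum_range_succ, Finset.sum_range_succ, Nat.choose_self,
    Nat.choose_succ_self_right (n + 1)] at h
  rw [Nat.add_sub_cancel, Nat.choose_succ_succ' m n,
    show m + 1 + n + 1 = m + n + 2 by ring, ← h]
  push_cast
  ring
end

section
/- For all integers n ≥ 2, r ≥ 1, and 0 ≤ k ≤ n, the following binomial identity holds: (n+1)·C(r−1, n−k) + ∑_{s=k}^{n−1} C(n+2, s+1)·C(r−1, s−k) = C(r+n+1, n−k+1) − C(r, n+1−k). (Multiplying both sides by C(r+k, k), this identity expresses that the dimension of the space of H(d)-conforming piecewise polynomial k-forms of degree ≤ r on the Alfeld split of an n-simplex equals C(r+k,k)[C(r+n+1, n−k+1) − C(r, n+1−k)].) -/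
/-- for `n ≥ 2`, `r ≥ 1` and `0 ≤ k ≤ n`,
`(n+1)·C(r−1, n−k) + ∑_{s=k}^{n−1} C(n+2, s+1)·C(r−1, s−k)
  = C(r+n+1, n−k+1) − C(r, n+1−k)`. -/
theorem statement16 (n r k : ℕ) (hn : 2 ≤ n) (hr : 1 ≤ r) (hk : k ≤ n) :
    ((n : ℤ) + 1) * (Nat.choose (r - 1) (n - k) : ℤ) +
        ∑ s ∈ Finset.Ico k n,
          (Nat.choose (n + 2) (s + 1) : ℤ) * (Nat.choose (r - 1) (s - k) : ℤ) =
      (Nat.choose (r + n + 1) (n - k + 1) : ℤ) - (Nat.choose r (n + 1 - k) : ℤ) := by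
  obtain ⟨m, rfl⟩ := Nat.exists_eq_add_of_le hk
  obtain ⟨q, rfl⟩ := Nat.exists_eq_add_of_le' hr
  have vandermonde := Nat.add_choose_eq q (k + m + 2) (m + 1)
  rw [Finset.Nat.sum_antidiagonal_eq_sum_range_succ_mk, Finset.sum_range_succ,
    Finset.sum_range_succ] at vandermonde
  have sum_eq : ∑ s ∈ Finset.Ico k (k + m),
      ((k + m + 2).choose (s + 1) : ℤ) * ((q + 1 - 1).choose (s - k) : ℤ) =
      ∑ j ∈ Finset.range m, (q.choose j : ℤ) * ((k + m + 2).choose (m + 1 - j) : ℤ) := by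
    rw [Finset.sum_Ico_eq_sum_range, Nat.add_sub_cancel_left]
    refine Finset.sum_congr rfl fun j hj => ?_
    have hj := Finset.mem_range.mp hj
    rw [Nat.add_sub_cancel_left, Nat.add_sub_cancel, mul_comm,
      Nat.choose_symm_of_eq_add (show k + m + 2 = (k + j + 1) + (m + 1 - j) by omega)]
  rw [sum_eq, Nat.add_sub_cancel, Nat.add_sub_cancel_left,
    show k + m + 1 - k = m + 1 by omega, Nat.choose_succ_succ q m,
    show q + 1 + (k + m) + 1 = q + (k + m + 2) by omega, vandermonde]
  simp only [Nat.add_sub_cancel_left, Nat.sub_self, Nat.choose_one_right, Nat.choose_zero_right]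
  push_cast
  ring
end
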